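/- There exists a constant M₀ > 0, depending only on n, M, β, with the following property: for every admissible drift B and every Green's function g of L = −Δ + B·∇ on Ω with pole at 0, there exist a sequence (a_k) of minimum points of g and a sequence (b_k) of maximum points of g, with |a_k| → 0 and |b_k| → 0 as k → ∞, such that for every k: |∂g/∂r(b_k)| · |b_k|^{n−1} < M₀ · |∂g/∂r(a_k)| · |a_k|^{n−1}. -/

import Mathlib

open Set Metric MeasureTheory Filter
open scoped RealInnerProductSpace Topology

noncomputable section

/-- Euclidean space `ℝⁿ`. -/
abbrev Euc (n : ℕ) := EuclideanSpace ℝ (Fin n)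

/-- The divergence `div B x = ∑ i ∂ᵢ Bᵢ (x)` of a vector field. -/
def divg {n : ℕ} (B : Euc n → Euc n) (x : Euc n) : ℝ :=
  ∑ i : Fin n, ⟪fderiv ℝ B x (EuclideanSpace.single i 1), EuclideanSpace.single i (1 : ℝ)⟫

/-- An admissible drift on the unit ball `Ω = B(0,1)`: `B` is continuously differentiable on
`Ω`, `δ(x)^(1-β) |B(x)| ≤ M` on `Ω` (where `δ(x) = 1 - |x|`), and
`-M δ(x)^(β-2) ≤ div B(x) ≤ 0` on `Ω`. -/
def AdmissibleDrift {n : ℕ} (β M : ℝ) (B : Euc n → Euc n) : Prop :=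
  ContDiffOn ℝ 1 B (ball 0 1) ∧
  (∀ x ∈ ball (0 : Euc n) 1, (1 - ‖x‖) ^ (1 - β) * ‖B x‖ ≤ M) ∧
  (∀ x ∈ ball (0 : Euc n) 1, -(M * (1 - ‖x‖) ^ (β - 2)) ≤ divg B x ∧ divg B x ≤ 0)

/-- A Green's function of `L = -Δ + B·∇` on the unit ball `Ω = B(0,1)` with pole at `y`:
positive on `Ω \ {y}`, three times continuously differentiable there, `g` and `|∇g|`
integrable on `Ω`, `g(x) → 0` as `|x| → 1`, and the weak formulation
`∫_Ω (⟨∇g, ∇φ⟩ + ⟨B, ∇g⟩ φ) = φ(y)` for every test function `φ ∈ C_c^∞(Ω)`. -/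
def IsGreenPole {n : ℕ} (B : Euc n → Euc n) (y : Euc n) (g : Euc n → ℝ) : Prop :=
  (∀ x ∈ ball (0 : Euc n) 1, x ≠ y → 0 < g x) ∧
  ContDiffOn ℝ 3 g (ball 0 1 \ {y}) ∧
  IntegrableOn g (ball 0 1) ∧
  IntegrableOn (fun x => ‖gradient g x‖) (ball 0 1) ∧
  (∀ ε > 0, ∃ t < (1 : ℝ), ∀ x ∈ ball (0 : Euc n) 1, t < ‖x‖ → |g x| < ε) ∧
  (∀ φ : Euc n → ℝ, ContDiff ℝ (⊤ : ℕ∞) φ → HasCompactSupport φ → tsupport φ ⊆ ball 0 1 →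
    (∫ x in ball (0 : Euc n) 1,
      (⟪gradient g x, gradient φ x⟫ + ⟪B x, gradient g x⟫ * φ x)) = φ y)


/-- `p ∈ Ω \ {0}` is a minimum point of `g` if it is at minimal distance from the origin
on its own level set `{x ∈ Ω \ {0} : g x = g p}`. -/
def IsMinPoint {n : ℕ} (g : Euc n → ℝ) (p : Euc n) : Prop :=
  p ∈ ball (0 : Euc n) 1 ∧ p ≠ 0 ∧
    ∀ x ∈ ball (0 : Euc n) 1, x ≠ 0 → g x = g p → ‖p‖ ≤ ‖x‖

/-- `p ∈ Ω \ {0}` is a maximum point of `g` if it is at maximal distance from the origin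
on its own level set `{x ∈ Ω \ {0} : g x = g p}`. -/
def IsMaxPoint {n : ℕ} (g : Euc n → ℝ) (p : Euc n) : Prop :=
  p ∈ ball (0 : Euc n) 1 ∧ p ≠ 0 ∧
    ∀ x ∈ ball (0 : Euc n) 1, x ≠ 0 → g x = g p → ‖x‖ ≤ ‖p‖

/-- The radial derivative `∂g/∂r (p) = ⟨∇g(p), p/|p|⟩`. -/
def radialDeriv {n : ℕ} (g : Euc n → ℝ) (p : Euc n) : ℝ :=
  ⟪gradient g p, ‖p‖⁻¹ • p⟫


/-! ### Partial derivatives -/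

/-- The `i`-th partial derivative of `f`. -/
def pd {n : ℕ} (i : Fin n) (f : Euc n → ℝ) (x : Euc n) : ℝ :=
  fderiv ℝ f x (EuclideanSpace.single i 1)

/-- The Laplacian written as the sum of the pure second partial derivatives. -/
def lapl {n : ℕ} (f : Euc n → ℝ) (x : Euc n) : ℝ := ∑ i, pd i (pd i f) x

section PartialDerivatives

variable {n : ℕ} {f h : Euc n → ℝ} {x : Euc n}

lemma gradient_apply_eq_pd (f : Euc n → ℝ) (x : Euc n) (i : Fin n) :
    (gradient f x) i = pd i f x := by
  have := inner_gradient_left (𝕜 := ℝ) (f := f) (x := x) (y := EuclideanSpace.single i 1)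
  rw [pd, ← this, EuclideanSpace.inner_single_right]
  simp

lemma inner_gradient_eq_sum_pd (v : Euc n) (f : Euc n → ℝ) (x : Euc n) :
    ⟪v, gradient f x⟫ = ∑ i, v i * pd i f x := by
  simp only [PiLp.inner_apply, gradient_apply_eq_pd, RCLike.inner_apply, conj_trivial, mul_comm]

lemma inner_gradient_gradient (f h : Euc n → ℝ) (x : Euc n) :
    ⟪gradient f x, gradient h x⟫ = ∑ i, pd i f x * pd i h x := by
  simp only [inner_gradient_eq_sum_pd, gradient_apply_eq_pd]

lemma norm_gradient_sq (f : Euc n → ℝ) (x : Euc n) :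
    ‖gradient f x‖ ^ 2 = ∑ i, pd i f x ^ 2 := by
  rw [← real_inner_self_eq_norm_sq, inner_gradient_gradient]
  simp only [sq]

lemma norm_gradient_eq_norm_fderiv (f : Euc n → ℝ) (x : Euc n) :
    ‖gradient f x‖ = ‖fderiv ℝ f x‖ := by
  rw [gradient, LinearIsometryEquiv.norm_map]

lemma pd_congr (i : Fin n) (e : f =ᶠ[𝓝 x] h) : pd i f x = pd i h x := by
  rw [pd, pd, e.fderiv_eq]

lemma pd_eventuallyEq (i : Fin n) (e : f =ᶠ[𝓝 x] h) : pd i f =ᶠ[𝓝 x] pd i h :=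
  e.eventuallyEq_nhds.mono fun _ hy => pd_congr i hy

lemma contDiffAt_pd {k m : WithTop ℕ∞} (i : Fin n) (hf : ContDiffAt ℝ m f x) (hk : k + 1 ≤ m) :
    ContDiffAt ℝ k (pd i f) x :=
  (hf.fderiv_right hk).clm_apply contDiffAt_const

lemma contDiff_pd {k m : WithTop ℕ∞} (i : Fin n) (hf : ContDiff ℝ m f) (hk : k + 1 ≤ m) :
    ContDiff ℝ k (pd i f) :=
  contDiff_iff_contDiffAt.2 fun _ => contDiffAt_pd i hf.contDiffAt hk

lemma pd_const (i : Fin n) (c : ℝ) : pd i (fun _ : Euc n => c) x = 0 := by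
  simp [pd]

lemma pd_add (i : Fin n) (hf : DifferentiableAt ℝ f x) (hh : DifferentiableAt ℝ h x) :
    pd i (fun y => f y + h y) x = pd i f x + pd i h x := by
  simp [pd, fderiv_fun_add hf hh]

lemma pd_sub (i : Fin n) (hf : DifferentiableAt ℝ f x) (hh : DifferentiableAt ℝ h x) :
    pd i (fun y => f y - h y) x = pd i f x - pd i h x := by
  simp [pd, fderiv_fun_sub hf hh]

lemma pd_mul (i : Fin n) (hf : DifferentiableAt ℝ f x) (hh : DifferentiableAt ℝ h x) :
    pd i (fun y => f y * h y) x = pd i f x * h x + f x * pd i h x := by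
  simp [pd, fderiv_fun_mul hf hh]; ring

lemma pd_sum {ι : Type*} (i : Fin n) (s : Finset ι) {F : ι → Euc n → ℝ}
    (hF : ∀ k ∈ s, DifferentiableAt ℝ (F k) x) :
    pd i (fun y => ∑ k ∈ s, F k y) x = ∑ k ∈ s, pd i (F k) x := by
  simp [pd, fderiv_fun_sum hF]

lemma pd_comp (i : Fin n) {φ : ℝ → ℝ} {φ' : ℝ} (hφ : HasDerivAt φ φ' (f x))
    (hf : DifferentiableAt ℝ f x) : pd i (fun y => φ (f y)) x = φ' * pd i f x := by
  have := (hφ.comp_hasFDerivAt x hf.hasFDerivAt).fderiv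
  rw [pd, show (fun y => φ (f y)) = φ ∘ f from rfl, this]
  simp [pd]

lemma pd_comm (i j : Fin n) (hf : ContDiffAt ℝ 2 f x) :
    pd i (pd j f) x = pd j (pd i f) x := by
  have hd : DifferentiableAt ℝ (fderiv ℝ f) x :=
    (hf.fderiv_right (m := 1) (by norm_num)).differentiableAt (by norm_num)
  have key : ∀ a b : Fin n, pd a (pd b f) x =
      fderiv ℝ (fderiv ℝ f) x (EuclideanSpace.single a 1) (EuclideanSpace.single b 1) := by
    intro a b
    have h1 : HasFDerivAt (pd b f) _ x := hd.hasFDerivAt.clm_apply (hasFDerivAt_const _ x)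
    rw [pd, h1.fderiv]
    simp
  rw [key, key]
  exact (hf.isSymmSndFDerivAt (by simp)).eq _ _

lemma ContDiffAt.eventually_differentiableAt {m : WithTop ℕ∞} (hf : ContDiffAt ℝ m f x)
    (hm : 1 ≤ m) : ∀ᶠ y in 𝓝 x, DifferentiableAt ℝ f y := by
  filter_upwards [(hf.of_le hm).eventually (by simp)] with y hy
  exact hy.differentiableAt (by norm_num)

lemma pd_pd_mul (i : Fin n) (hf : ContDiffAt ℝ 2 f x) (hh : ContDiffAt ℝ 2 h x) :
    pd i (pd i fun y => f y * h y) x =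
      pd i (pd i f) x * h x + 2 * (pd i f x * pd i h x) + f x * pd i (pd i h) x := by
  have e : pd i (fun y => f y * h y) =ᶠ[𝓝 x] fun y => pd i f y * h y + f y * pd i h y := by
    filter_upwards [hf.eventually_differentiableAt (by norm_num),
      hh.eventually_differentiableAt (by norm_num)] with y h1 h2 using pd_mul i h1 h2
  have f0 := hf.differentiableAt (by norm_num)
  have h0 := hh.differentiableAt (by norm_num)
  have f1 := (contDiffAt_pd (k := 1) i hf (by norm_num)).differentiableAt (by norm_num)
  have h1 := (contDiffAt_pd (k := 1) i hh (by norm_num)).differentiableAt (by norm_num)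
  rw [pd_congr i e, pd_add i (f1.fun_mul h0) (f0.fun_mul h1), pd_mul i f1 h0, pd_mul i f0 h1]
  ring

lemma pd_pd_sum {ι : Type*} (i : Fin n) (s : Finset ι) {F : ι → Euc n → ℝ}
    (hF : ∀ k ∈ s, ContDiffAt ℝ 2 (F k) x) :
    pd i (pd i fun y => ∑ k ∈ s, F k y) x = ∑ k ∈ s, pd i (pd i (F k)) x := by
  have e : pd i (fun y => ∑ k ∈ s, F k y) =ᶠ[𝓝 x] fun y => ∑ k ∈ s, pd i (F k) y := by
    have := (Filter.eventually_all_finset s).2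
      fun k hk => (hF k hk).eventually_differentiableAt (by norm_num)
    filter_upwards [this] with y hy using pd_sum i s hy
  rw [pd_congr i e, pd_sum i s]
  exact fun k hk =>
    (contDiffAt_pd (k := 1) i (hF k hk) (by norm_num)).differentiableAt (by norm_num)

lemma pd_pd_comp (i : Fin n) {φ φ' : ℝ → ℝ} {φ'' : ℝ}
    (hφ : ∀ᶠ s in 𝓝 (f x), HasDerivAt φ (φ' s) s) (hφ' : HasDerivAt φ' φ'' (f x))
    (hf : ContDiffAt ℝ 2 f x) :
    pd i (pd i fun y => φ (f y)) x = φ'' * pd i f x ^ 2 + φ' (f x) * pd i (pd i f) x := by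
  have e : pd i (fun y => φ (f y)) =ᶠ[𝓝 x] fun y => φ' (f y) * pd i f y := by
    filter_upwards [hf.eventually_differentiableAt (by norm_num),
      hf.continuousAt.eventually hφ] with y h1 h2 using pd_comp i h2 h1
  have f0 := hf.differentiableAt (by norm_num)
  have f1 := (contDiffAt_pd (k := 1) i hf (by norm_num)).differentiableAt (by norm_num)
  have f2 : DifferentiableAt ℝ (fun y => φ' (f y)) x := hφ'.differentiableAt.comp x f0
  rw [pd_congr i e, pd_mul i f2 f1, pd_comp i hφ' f0]
  ring

lemma IsLocalMax.pd_eq_zero (i : Fin n) (hf : IsLocalMax f x) : pd i f x = 0 := by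
  simp [pd, hf.fderiv_eq_zero]

lemma IsLocalMax.pd_pd_nonpos (i : Fin n) (hm : IsLocalMax f x) (hf : ContDiffAt ℝ 2 f x) :
    pd i (pd i f) x ≤ 0 := by
  set e : Euc n := EuclideanSpace.single i 1
  set ℓ : ℝ → Euc n := fun t => x + t • e
  have hℓ : ∀ t, HasDerivAt ℓ e t := fun t => by
    simpa only [id, one_smul] using ((hasDerivAt_id t).smul_const e).const_add x
  have hℓ0 : ℓ 0 = x := by simp [ℓ]
  have hc : Tendsto ℓ (𝓝 0) (𝓝 x) := by
    simpa [hℓ0] using (hℓ 0).continuousAt.tendsto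
  have d1 : ∀ᶠ t in 𝓝 (0 : ℝ), HasDerivAt (f ∘ ℓ) (pd i f (ℓ t)) t := by
    filter_upwards [hc.eventually (hf.eventually_differentiableAt (by norm_num))] with t ht
    exact ht.hasFDerivAt.comp_hasDerivAt t (hℓ t)
  have d2 : HasDerivAt (fun t => pd i f (ℓ t)) (pd i (pd i f) x) 0 := by
    have f1 := (contDiffAt_pd (k := 1) i hf (by norm_num)).differentiableAt (by norm_num)
    have := (hℓ0.symm ▸ f1 : DifferentiableAt ℝ (pd i f) (ℓ 0)).hasFDerivAt.comp_hasDerivAt 0 (hℓ 0)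
    rw [hℓ0] at this
    exact this
  have ed : deriv (f ∘ ℓ) =ᶠ[𝓝 0] fun t => pd i f (ℓ t) := d1.mono fun t ht => ht.deriv
  have hdd : deriv (deriv (f ∘ ℓ)) 0 = pd i (pd i f) x := by rw [ed.deriv_eq, d2.deriv]
  have hmax : IsLocalMax (f ∘ ℓ) 0 := by
    have := hc.eventually hm
    filter_upwards [this] with t ht
    simpa [hℓ0] using ht
  by_contra! hpos
  have hmin := isLocalMin_of_deriv_deriv_pos (f := f ∘ ℓ) (x₀ := 0) (by rw [hdd]; exact hpos)
    hmax.deriv_eq_zero d1.self_of_nhds.continuousAt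
  have hconst : (f ∘ ℓ) =ᶠ[𝓝 0] fun _ => (f ∘ ℓ) 0 := by
    filter_upwards [hmin, hmax] with t h1 h2 using le_antisymm h2 h1
  have h0 : deriv (f ∘ ℓ) =ᶠ[𝓝 0] fun _ => 0 := by
    filter_upwards [hconst.eventuallyEq_nhds] with t ht
    rw [ht.deriv_eq]; simp
  rw [← hdd, h0.deriv_eq] at hpos
  simp at hpos

end PartialDerivatives

/-! ### Interior gradient estimate -/

section GradientEstimate

variable {n : ℕ}

lemma hasFDerivAt_norm_sub_sq (x₀ x : Euc n) :
    HasFDerivAt (fun y : Euc n => ‖y - x₀‖ ^ 2) (2 • innerSL ℝ (x - x₀)) x := by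
  simpa using ((hasFDerivAt_id x).sub_const x₀).norm_sq

lemma contDiff_norm_sub_sq {m : WithTop ℕ∞} (x₀ : Euc n) :
    ContDiff ℝ m fun y : Euc n => ‖y - x₀‖ ^ 2 :=
  (contDiff_id.sub contDiff_const).norm_sq ℝ

lemma pd_norm_sub_sq (j : Fin n) (x₀ : Euc n) :
    pd j (fun y : Euc n => ‖y - x₀‖ ^ 2) = fun x => 2 * (x j - x₀ j) := by
  ext x
  rw [pd, (hasFDerivAt_norm_sub_sq x₀ x).fderiv]
  simp [EuclideanSpace.inner_single_right]

lemma pd_pd_norm_sub_sq (j : Fin n) (x₀ x : Euc n) :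
    pd j (pd j fun y : Euc n => ‖y - x₀‖ ^ 2) x = 2 := by
  rw [pd_norm_sub_sq]
  have h : HasFDerivAt (fun x : Euc n => 2 * (x j - x₀ j))
      ((2 : ℝ) • (EuclideanSpace.proj j : Euc n →L[ℝ] ℝ)) x :=
    (((EuclideanSpace.proj j : Euc n →L[ℝ] ℝ).hasFDerivAt (x := x)).sub_const (x₀ j)).const_mul 2
  rw [pd, h.fderiv]
  simp

lemma sq_bound_of_bernstein_ineq {N η w R E HH Q p q t : ℝ} (hN : 1 ≤ N) (hη : 0 < η)
    (hηR : η ≤ R ^ 2) (hR : 0 < R) (hw : 0 < w) (hH : (t - w) ^ 2 ≤ N * HH)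
    (ht : R ^ 2 * t ^ 2 ≤ w) (hp : |p| ≤ 2) (hq : q ^ 2 ≤ 4 * R ^ 2 * w)
    (hQ : R ^ 2 * |Q| ≤ w) (hE : E ≤ 4 * R ^ 2)
    (hmax : -6 * w * E - 4 * N * η * w + 2 * η ^ 2 * HH + 2 * η ^ 2 * Q - 2 * η * w * p
      + 4 * η * w * q ≤ 0) :
    η ^ 2 * w ≤ (50 * N * R) ^ 2 := by
  obtain ⟨y, hy, rfl⟩ : ∃ y : ℝ, 0 < y ∧ y ^ 2 = w :=
    ⟨√w, Real.sqrt_pos.2 hw, Real.sq_sqrt hw.le⟩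
  have hR2 : 0 < R ^ 2 := by positivity
  have hq' : |q| ≤ 2 * R * y := by
    apply abs_le_of_sq_le_sq _ (by positivity)
    nlinarith
  have hηw : η * y ^ 2 ≤ R ^ 2 * y ^ 2 := by gcongr
  have hηη : η ^ 2 ≤ η * R ^ 2 := by nlinarith
  have b1 : y ^ 2 * E ≤ 4 * R ^ 2 * y ^ 2 := by nlinarith
  have b2 : -(η ^ 2 * Q) ≤ R ^ 2 * y ^ 2 := by
    calc -(η ^ 2 * Q) = η ^ 2 * -Q := by ring
      _ ≤ η ^ 2 * |Q| := by gcongr; exact neg_le_abs Q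
      _ ≤ (η * R ^ 2) * |Q| := by gcongr
      _ = η * (R ^ 2 * |Q|) := by ring
      _ ≤ η * y ^ 2 := by gcongr
      _ ≤ _ := hηw
  have b3 : η * y ^ 2 * p ≤ 2 * (R ^ 2 * y ^ 2) := by
    calc η * y ^ 2 * p ≤ η * y ^ 2 * 2 := by gcongr; exact (le_abs_self p).trans hp
      _ ≤ _ := by linarith
  have b4 : -(η * y ^ 2 * q) ≤ 2 * R * y * (η * y ^ 2) := by
    calc -(η * y ^ 2 * q) = η * y ^ 2 * -q := by ring
      _ ≤ η * y ^ 2 * (2 * R * y) := by gcongr; exact (neg_le_abs q).trans hq'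
      _ = _ := by ring
  have b5 : η ^ 2 * t ^ 2 ≤ R ^ 2 * y ^ 2 := by
    calc η ^ 2 * t ^ 2 ≤ (η * R ^ 2) * t ^ 2 := by gcongr
      _ = η * (R ^ 2 * t ^ 2) := by ring
      _ ≤ η * y ^ 2 := by gcongr
      _ ≤ _ := hηw
  have b6 : 2 * η ^ 2 * HH ≤ (30 + 4 * N) * R ^ 2 * y ^ 2 + 8 * R * y * (η * y ^ 2) := by
    have : 4 * N * η * y ^ 2 ≤ 4 * N * (R ^ 2 * y ^ 2) := by
      have := mul_le_mul_of_nonneg_left hηw (show 0 ≤ 4 * N by linarith)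
      linarith
    nlinarith
  have b7 : η ^ 2 * (y ^ 2) ^ 2 ≤ 2 * η ^ 2 * (t - y ^ 2) ^ 2 + 2 * (η ^ 2 * t ^ 2) := by
    nlinarith [mul_nonneg (sq_nonneg η) (sq_nonneg (2 * t - y ^ 2))]
  have b8 : 2 * η ^ 2 * (t - y ^ 2) ^ 2 ≤ N * (2 * η ^ 2 * HH) := by
    nlinarith [mul_le_mul_of_nonneg_left hH (show 0 ≤ 2 * η ^ 2 by positivity)]
  have b9 : N * (2 * η ^ 2 * HH) ≤
      N * ((30 + 4 * N) * R ^ 2 * y ^ 2 + 8 * R * y * (η * y ^ 2)) := by gcongr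
  set z := η * y with hz
  have hz0 : 0 < z := by positivity
  have b10 : z ^ 2 * y ^ 2 ≤ (36 * N ^ 2 * R ^ 2 + 8 * N * R * z) * y ^ 2 := by
    have e1 : z ^ 2 * y ^ 2 = η ^ 2 * (y ^ 2) ^ 2 := by rw [hz]; ring
    have e2 : N * ((30 + 4 * N) * R ^ 2 * y ^ 2 + 8 * R * y * (η * y ^ 2)) + 2 * (R ^ 2 * y ^ 2)
        = ((2 + 30 * N + 4 * N ^ 2) * R ^ 2 + 8 * N * R * z) * y ^ 2 := by rw [hz]; ring
    have e3 : (2 + 30 * N + 4 * N ^ 2) * R ^ 2 ≤ 36 * N ^ 2 * R ^ 2 := by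
      gcongr; nlinarith
    calc z ^ 2 * y ^ 2 ≤ ((2 + 30 * N + 4 * N ^ 2) * R ^ 2 + 8 * N * R * z) * y ^ 2 := by
          rw [e1, ← e2]; linarith
      _ ≤ _ := by gcongr
  have b11 : z ^ 2 ≤ 36 * N ^ 2 * R ^ 2 + 8 * N * R * z :=
    le_of_mul_le_mul_right b10 (by positivity)
  have b12 : z ≤ 50 * N * R := by
    by_contra! h
    have hNR : 0 < N * R := by positivity
    nlinarith
  calc η ^ 2 * y ^ 2 = z ^ 2 := by rw [hz]; ring
    _ ≤ _ := by gcongr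

lemma abs_bilin_sum_le {D : Euc n →L[ℝ] Euc n} (a : Euc n) :
    |∑ k, ∑ i, D (EuclideanSpace.single i 1) k * a k * a i| ≤ ‖D‖ * ‖a‖ ^ 2 := by
  have e : ∑ k, ∑ i, D (EuclideanSpace.single i 1) k * a k * a i = ⟪D a, a⟫ := by
    conv_rhs => rw [← (EuclideanSpace.basisFun (Fin n) ℝ).sum_repr a]
    simp only [EuclideanSpace.basisFun_repr, EuclideanSpace.basisFun_apply, map_sum, map_smul,
      PiLp.inner_apply]
    simp [Finset.sum_apply, Finset.mul_sum, Pi.single_apply]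
    refine Finset.sum_congr rfl fun k _ => Finset.sum_congr rfl fun i _ => by ring
  rw [e]
  calc |⟪D a, a⟫| ≤ ‖D a‖ * ‖a‖ := abs_real_inner_le_norm _ _
    _ ≤ ‖D‖ * ‖a‖ * ‖a‖ := by gcongr; exact D.le_opNorm a
    _ = _ := by ring

lemma sq_bound_of_max_point {R η : ℝ} {a b e : Fin n → ℝ} {H : Fin n → Fin n → ℝ}
    {D : Fin n → Fin n → ℝ} {T : Fin n → ℝ} (hn : 1 ≤ n) (hη : 0 < η) (hηR : η ≤ R ^ 2)
    (hR : 0 < R) (hw : 0 < ∑ i, a i ^ 2) (hsymm : ∀ i j, H i j = H j i)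
    (hb : R ^ 2 * ∑ i, b i ^ 2 ≤ 1)
    (hD : R ^ 2 * |∑ k, ∑ i, D k i * a k * a i| ≤ ∑ i, a i ^ 2)
    (he : ∑ i, e i ^ 2 ≤ 4 * R ^ 2)
    (hT : ∀ i, T i = ∑ k, (D k i * a k + b k * H k i) - 2 * ∑ k, a k * H k i)
    (htr : ∑ i, H i i = ∑ i, b i * a i - ∑ i, a i ^ 2)
    (hcrit : ∀ j, η * ∑ i, a i * H i j = - e j * ∑ i, a i ^ 2)
    (hmax : 2 * (∑ i, a i ^ 2) * ∑ j, e j ^ 2 - 4 * n * η * ∑ i, a i ^ 2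
      + 8 * η * ∑ j, e j * ∑ i, a i * H i j + 2 * η ^ 2 * ∑ j, ∑ i, H i j ^ 2
      + 2 * η ^ 2 * ∑ i, a i * T i ≤ 0) :
    η ^ 2 * ∑ i, a i ^ 2 ≤ (50 * n * R) ^ 2 := by
  set w := ∑ i, a i ^ 2 with hwdef
  have hR2 : 0 < R ^ 2 := by positivity
  have cs := fun f g : Fin n → ℝ => Finset.sum_mul_sq_le_sq_mul_sq Finset.univ f g
  have hb0 : 0 ≤ ∑ i, b i ^ 2 := Finset.sum_nonneg fun i _ => sq_nonneg _
  have he0 : 0 ≤ ∑ i, e i ^ 2 := Finset.sum_nonneg fun i _ => sq_nonneg _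
  have c1 : η * ∑ j, e j * ∑ i, a i * H i j = - w * ∑ j, e j ^ 2 := by
    rw [Finset.mul_sum, Finset.mul_sum]
    refine Finset.sum_congr rfl fun j _ => ?_
    linear_combination e j * hcrit j
  have c2 : η * ∑ j, b j * ∑ i, a i * H i j = - w * ∑ j, b j * e j := by
    rw [Finset.mul_sum, Finset.mul_sum]
    refine Finset.sum_congr rfl fun j _ => ?_
    linear_combination b j * hcrit j
  have c3 : η * ∑ j, a j * ∑ i, a i * H i j = - w * ∑ j, a j * e j := by
    rw [Finset.mul_sum, Finset.mul_sum]
    refine Finset.sum_congr rfl fun j _ => ?_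
    linear_combination a j * hcrit j
  have c4 : ∑ i, a i * T i = ∑ k, ∑ i, D k i * a k * a i + ∑ j, b j * ∑ i, a i * H i j
      - 2 * ∑ j, a j * ∑ i, a i * H i j := by
    rw [Finset.sum_comm (f := fun k i => D k i * a k * a i), Finset.mul_sum]
    simp_rw [Finset.mul_sum]
    rw [Finset.sum_comm (f := fun j i => b j * (a i * H i j)),
      ← Finset.sum_add_distrib, ← Finset.sum_sub_distrib]
    refine Finset.sum_congr rfl fun i _ => ?_
    rw [hT, mul_sub, Finset.mul_sum, Finset.mul_sum, Finset.mul_sum, ← Finset.sum_add_distrib]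
    congr 1
    · refine Finset.sum_congr rfl fun k _ => ?_
      rw [hsymm k i]; ring
    · refine Finset.sum_congr rfl fun k _ => ?_
      ring
  refine sq_bound_of_bernstein_ineq (N := n) (E := ∑ j, e j ^ 2) (HH := ∑ j, ∑ i, H i j ^ 2)
    (Q := ∑ k, ∑ i, D k i * a k * a i) (p := ∑ j, b j * e j) (q := ∑ j, a j * e j)
    (t := ∑ i, b i * a i) (by exact_mod_cast hn) hη hηR hR hw ?_ ?_ ?_ ?_ hD he ?_
  · rw [← htr]
    calc (∑ i, H i i) ^ 2 ≤ n * ∑ i, H i i ^ 2 := by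
          simpa using sq_sum_le_card_mul_sum_sq (s := Finset.univ) (f := fun i => H i i)
      _ ≤ n * ∑ j, ∑ i, H i j ^ 2 := by
          gcongr with j
          exact Finset.single_le_sum (f := fun i => H i j ^ 2) (fun i _ => sq_nonneg _)
            (Finset.mem_univ j)
  · calc R ^ 2 * (∑ i, b i * a i) ^ 2 ≤ R ^ 2 * ((∑ i, b i ^ 2) * w) := by gcongr; exact cs b a
      _ = (R ^ 2 * ∑ i, b i ^ 2) * w := by ring
      _ ≤ 1 * w := by gcongr
      _ = w := one_mul w
  · apply abs_le_of_sq_le_sq _ (by norm_num)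
    calc (∑ j, b j * e j) ^ 2 ≤ (∑ i, b i ^ 2) * ∑ j, e j ^ 2 := cs b e
      _ ≤ (∑ i, b i ^ 2) * (4 * R ^ 2) := by gcongr
      _ = 4 * (R ^ 2 * ∑ i, b i ^ 2) := by ring
      _ ≤ 2 ^ 2 := by linarith
  · calc (∑ j, a j * e j) ^ 2 ≤ w * ∑ j, e j ^ 2 := cs a e
      _ ≤ w * (4 * R ^ 2) := by gcongr
      _ = _ := by ring
  · rw [c4] at hmax
    linear_combination hmax + (-8) * c1 - 2 * η * c2 + 4 * η * c3

end GradientEstimate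

section BernsteinEstimate

variable {n : ℕ}

lemma pd_vector_apply {B : Euc n → Euc n} {x : Euc n} (hB : DifferentiableAt ℝ B x)
    (i k : Fin n) :
    pd i (fun y => B y k) x = fderiv ℝ B x (EuclideanSpace.single i 1) k := by
  have h : HasFDerivAt (fun y => B y k)
      ((EuclideanSpace.proj k : Euc n →L[ℝ] ℝ).comp (fderiv ℝ B x)) x :=
    (EuclideanSpace.proj k : Euc n →L[ℝ] ℝ).hasFDerivAt.comp x hB.hasFDerivAt
  rw [pd, h.fderiv]
  simp

lemma differentiableAt_vector_apply {B : Euc n → Euc n} {x : Euc n}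
    (hB : DifferentiableAt ℝ B x) (k : Fin n) : DifferentiableAt ℝ (fun y => B y k) x :=
  ((EuclideanSpace.proj k : Euc n →L[ℝ] ℝ).hasFDerivAt.comp x hB.hasFDerivAt).differentiableAt

/-- Differentiating the equation `Δu = B·∇u - |∇u|²`. -/
lemma sum_pd_pd_pd_eq {u : Euc n → ℝ} {B : Euc n → Euc n} {x : Euc n} (hu : ContDiffAt ℝ 3 u x)
    (hB : DifferentiableAt ℝ B x)
    (heq : ∀ᶠ y in 𝓝 x, lapl u y = ∑ i, B y i * pd i u y - ∑ i, pd i u y ^ 2) (i : Fin n) :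
    ∑ j, pd j (pd j (pd i u)) x =
      ∑ k, (fderiv ℝ B x (EuclideanSpace.single i 1) k * pd k u x + B x k * pd i (pd k u) x)
        - 2 * ∑ k, pd k u x * pd i (pd k u) x := by
  have hu2 : ∀ k, ContDiffAt ℝ 2 (pd k u) x := fun k => contDiffAt_pd k hu (by norm_num)
  have hu1 : ∀ j k, ContDiffAt ℝ 1 (pd j (pd k u)) x :=
    fun j k => contDiffAt_pd j (hu2 k) (by norm_num)
  have d1 : ∀ k, DifferentiableAt ℝ (pd k u) x := fun k =>
    (hu2 k).differentiableAt (by norm_num)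
  have hB1 := differentiableAt_vector_apply hB
  have step : ∀ j, pd j (pd j (pd i u)) x = pd i (pd j (pd j u)) x := by
    intro j
    have e : pd j (pd i u) =ᶠ[𝓝 x] pd i (pd j u) := by
      filter_upwards [(hu.of_le (by norm_num : (2 : WithTop ℕ∞) ≤ 3)).eventually (by simp)]
        with y hy using pd_comm j i hy
    rw [pd_congr j e, pd_comm j i (hu2 j)]
  have hlap : pd i (lapl u) x = ∑ j, pd i (pd j (pd j u)) x :=
    pd_sum i Finset.univ fun j _ => (hu1 j j).differentiableAt (by norm_num)
  rw [Finset.sum_congr rfl fun j _ => step j, ← hlap, pd_congr i heq,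
    pd_sub i (DifferentiableAt.fun_sum fun k _ => (hB1 k).fun_mul (d1 k))
      (DifferentiableAt.fun_sum fun k _ => (d1 k).fun_pow 2),
    pd_sum i _ fun k _ => (hB1 k).fun_mul (d1 k), pd_sum i _ fun k _ => (d1 k).fun_pow 2,
    Finset.mul_sum]
  congr 1
  · refine Finset.sum_congr rfl fun k _ => ?_
    rw [pd_mul i (hB1 k) (d1 k), pd_vector_apply hB]
  · refine Finset.sum_congr rfl fun k _ => ?_
    simp only [sq]
    rw [pd_mul i (d1 k) (d1 k)]
    ring

/-- Interior gradient estimate for `Δu = B·∇u - |∇u|²`, the equation satisfied by the logarithm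
of a positive solution of `Δg = B·∇g`. -/
theorem norm_gradient_le_of_lapl_eq (hn : 1 ≤ n) {u : Euc n → ℝ} {B : Euc n → Euc n} {x₀ : Euc n}
    {R : ℝ} (hR : 0 < R) (hu : ∀ x ∈ closedBall x₀ R, ContDiffAt ℝ 3 u x)
    (hB : ∀ x ∈ ball x₀ R, DifferentiableAt ℝ B x)
    (hBR : ∀ x ∈ ball x₀ R, R * ‖B x‖ ≤ 1)
    (hDB : ∀ x ∈ ball x₀ R, R ^ 2 * ‖fderiv ℝ B x‖ ≤ 1)
    (heq : ∀ x ∈ ball x₀ R, lapl u x = ∑ i, B x i * pd i u x - ∑ i, pd i u x ^ 2) :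
    R * ‖gradient u x₀‖ ≤ 50 * n := by
  set η : Euc n → ℝ := fun x => R ^ 2 - ‖x - x₀‖ ^ 2 with hηdef
  set w : Euc n → ℝ := fun x => ∑ i, pd i u x * pd i u x with hwdef
  set G : Euc n → ℝ := fun x => (η x * η x) * w x with hGdef
  have hw2 : ∀ x, w x = ∑ i, pd i u x ^ 2 := fun x => by simp only [hwdef, sq]
  have hη2 : ∀ x, ContDiffAt ℝ 2 η x := fun x =>
    (contDiff_const.sub (contDiff_norm_sub_sq x₀)).contDiffAt
  have hu2 : ∀ x ∈ closedBall x₀ R, ∀ k, ContDiffAt ℝ 2 (pd k u) x :=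
    fun x hx k => contDiffAt_pd k (hu x hx) (by norm_num)
  have hwc : ∀ x ∈ closedBall x₀ R, ContDiffAt ℝ 2 w x := fun x hx =>
    ContDiffAt.sum fun k _ => (hu2 x hx k).mul (hu2 x hx k)
  have hGc : ∀ x ∈ closedBall x₀ R, ContDiffAt ℝ 2 G x := fun x hx =>
    ((hη2 x).mul (hη2 x)).mul (hwc x hx)
  obtain ⟨p, hp, hpmax⟩ := (isCompact_closedBall x₀ R).exists_isMaxOn
    ⟨x₀, mem_closedBall_self hR.le⟩
    fun x hx => (hGc x hx).continuousAt.continuousWithinAt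
  have hx₀ : G x₀ ≤ G p := hpmax (mem_closedBall_self hR.le)
  have hGx₀ : G x₀ = R ^ 2 * (R * ‖gradient u x₀‖) ^ 2 := by
    simp only [hGdef, hw2, hηdef, sub_self, norm_zero, mul_pow, norm_gradient_sq]
    ring
  suffices h : G p ≤ (50 * n * R) ^ 2 by
    rw [hGx₀] at hx₀
    have h1 : R ^ 2 * (R * ‖gradient u x₀‖) ^ 2 ≤ R ^ 2 * (50 * n) ^ 2 := by
      calc _ ≤ _ := hx₀.trans h
        _ = _ := by ring
    exact le_of_sq_le_sq (le_of_mul_le_mul_left h1 (by positivity)) (by positivity)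
  rcases le_or_gt (G p) 0 with hGp | hGp
  · exact hGp.trans (by positivity)
  have hwp0 : 0 ≤ w p := by rw [hw2]; exact Finset.sum_nonneg fun i _ => sq_nonneg _
  have hηp : η p ≠ 0 := by
    intro h; simp [hGdef, h] at hGp
  have hwp : 0 < w p := by
    refine lt_of_le_of_ne hwp0 fun h => ?_
    simp [hGdef, ← h] at hGp
  have hpb : p ∈ ball x₀ R := by
    rw [mem_ball]
    refine lt_of_le_of_ne (mem_closedBall.1 hp) fun h => hηp ?_
    rw [dist_eq_norm] at h
    simp [hηdef, h]
  have hηpos : 0 < η p := by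
    rw [mem_ball, dist_eq_norm] at hpb
    simp only [hηdef]
    have := norm_nonneg (p - x₀)
    nlinarith
  have hloc : IsLocalMax G p :=
    hpmax.isLocalMax (closedBall_mem_nhds_of_mem hpb)
  have pη : ∀ j x, pd j η x = -(2 * (x j - x₀ j)) := by
    intro j x
    rw [hηdef, pd_sub j (differentiableAt_const _)
      ((contDiff_norm_sub_sq (m := 1) x₀).contDiffAt.differentiableAt (by norm_num)),
      pd_const, pd_norm_sub_sq, zero_sub]
  have ppη : ∀ j, pd j (pd j η) p = -2 := by
    intro j
    have e : pd j η = fun x => 0 - pd j (fun y : Euc n => ‖y - x₀‖ ^ 2) x := by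
      ext x; rw [pη, pd_norm_sub_sq, zero_sub]
    rw [e, pd_sub j (differentiableAt_const _)
      ((contDiff_pd (k := 1) (m := 2) j (contDiff_norm_sub_sq x₀)
        (by norm_num)).contDiffAt.differentiableAt (by norm_num)),
      pd_const, pd_pd_norm_sub_sq, zero_sub]
  have d1 : ∀ k, DifferentiableAt ℝ (pd k u) p := fun k =>
    (hu2 p hp k).differentiableAt (by norm_num)
  have dη : DifferentiableAt ℝ η p := (hη2 p).differentiableAt (by norm_num)
  have dw : DifferentiableAt ℝ w p := (hwc p hp).differentiableAt (by norm_num)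
  have pw : ∀ j, pd j w p = 2 * ∑ i, pd i u p * pd j (pd i u) p := by
    intro j
    rw [hwdef, pd_sum j _ fun k _ => (d1 k).fun_mul (d1 k), Finset.mul_sum]
    refine Finset.sum_congr rfl fun k _ => ?_
    rw [pd_mul j (d1 k) (d1 k)]; ring
  have ppw : ∀ j, pd j (pd j w) p =
      2 * ∑ i, pd j (pd i u) p ^ 2 + 2 * ∑ i, pd i u p * pd j (pd j (pd i u)) p := by
    intro j
    rw [hwdef, pd_pd_sum j _ fun k _ => (hu2 p hp k).mul (hu2 p hp k), Finset.mul_sum,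
      Finset.mul_sum, ← Finset.sum_add_distrib]
    refine Finset.sum_congr rfl fun k _ => ?_
    rw [pd_pd_mul j (hu2 p hp k) (hu2 p hp k)]; ring
  have crit : ∀ j, η p * ∑ i, pd i u p * pd j (pd i u) p = - pd j η p * w p := by
    intro j
    have h := hloc.pd_eq_zero j
    rw [hGdef, pd_mul j (dη.fun_mul dη) dw, pd_mul j dη dη, pw] at h
    have : (2 * η p) * (η p * ∑ i, pd i u p * pd j (pd i u) p + pd j η p * w p) = 0 := by
      linear_combination h
    have := (mul_eq_zero.1 this).resolve_left (by positivity)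
    linarith
  have hess : ∀ j, 2 * w p * pd j η p ^ 2 - 4 * η p * w p
      + 8 * η p * (pd j η p * ∑ i, pd i u p * pd j (pd i u) p)
      + 2 * η p ^ 2 * ∑ i, pd j (pd i u) p ^ 2
      + 2 * η p ^ 2 * ∑ i, pd i u p * pd j (pd j (pd i u)) p ≤ 0 := by
    intro j
    have h := hloc.pd_pd_nonpos j (hGc p hp)
    rw [hGdef, pd_pd_mul j ((hη2 p).mul (hη2 p)) (hwc p hp), pd_pd_mul j (hη2 p) (hη2 p),
      pd_mul j dη dη, pw, ppw, ppη] at h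
    linear_combination h
  have hsum := Finset.sum_nonpos fun j (_ : j ∈ Finset.univ) => hess j
  simp only [Finset.sum_add_distrib, Finset.sum_sub_distrib, ← Finset.mul_sum,
    Finset.sum_const, Finset.card_univ, Fintype.card_fin, nsmul_eq_mul] at hsum
  have hev : ∀ᶠ y in 𝓝 p, lapl u y = ∑ i, B y i * pd i u y - ∑ i, pd i u y ^ 2 :=
    (isOpen_ball.eventually_mem hpb).mono heq
  have hT := sum_pd_pd_pd_eq (hu p hp) (hB p hpb) hev
  have hswap : ∑ j, ∑ i, pd i u p * pd j (pd j (pd i u)) p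
      = ∑ i, pd i u p * ∑ j, pd j (pd j (pd i u)) p := by
    rw [Finset.sum_comm]; simp only [Finset.mul_sum]
  have hpn : ‖p - x₀‖ ≤ R := by simpa [dist_eq_norm] using hp
  have := sq_bound_of_max_point (R := R) (η := η p) (a := fun i => pd i u p) (b := fun i => B p i)
    (e := fun j => pd j η p) (H := fun i j => pd j (pd i u) p)
    (D := fun k i => fderiv ℝ B p (EuclideanSpace.single i 1) k)
    (T := fun i => ∑ j, pd j (pd j (pd i u)) p) hn hηpos
    (by simp only [hηdef]; nlinarith [sq_nonneg ‖p - x₀‖]) hR (by rw [← hw2]; exact hwp)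
    (fun i j => pd_comm j i ((hu p hp).of_le (by norm_num)))
    ?_ ?_ ?_ hT (heq p hpb) (fun j => by rw [← hw2]; exact crit j) ?_
  · rw [← hw2] at this
    calc G p = η p ^ 2 * w p := by simp only [hGdef]; ring
      _ ≤ _ := this
  · have h := hBR p hpb
    rw [← EuclideanSpace.real_norm_sq_eq]
    calc R ^ 2 * ‖B p‖ ^ 2 = (R * ‖B p‖) ^ 2 := by ring
      _ ≤ 1 := pow_le_one₀ (by positivity) h
  · have h := abs_bilin_sum_le (D := fderiv ℝ B p) (gradient u p)
    simp only [gradient_apply_eq_pd, norm_gradient_sq] at h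
    calc _ ≤ R ^ 2 * (‖fderiv ℝ B p‖ * ∑ i, pd i u p ^ 2) := by gcongr
      _ = (R ^ 2 * ‖fderiv ℝ B p‖) * ∑ i, pd i u p ^ 2 := by ring
      _ ≤ 1 * ∑ i, pd i u p ^ 2 := by
        gcongr
        exact hDB p hpb
      _ = _ := one_mul _
  · calc ∑ j, pd j η p ^ 2 = 4 * ‖p - x₀‖ ^ 2 := by
          rw [EuclideanSpace.real_norm_sq_eq, Finset.mul_sum]
          refine Finset.sum_congr rfl fun j _ => ?_
          rw [pη]; simp; ring
      _ ≤ _ := by gcongr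
  · rw [← hw2, ← hswap]
    linear_combination hsum

end BernsteinEstimate

/-! ### The pointwise equation -/

section PointwiseEquation

variable {n : ℕ}

lemma tsupport_pd_subset (i : Fin n) (φ : Euc n → ℝ) : tsupport (pd i φ) ⊆ tsupport φ :=
  tsupport_fderiv_apply_subset ℝ _

lemma HasCompactSupport.pd {φ : Euc n → ℝ} (hφ : HasCompactSupport φ) (i : Fin n) :
    HasCompactSupport (pd i φ) :=
  hφ.mono' ((subset_tsupport _).trans (tsupport_pd_subset i φ))

lemma integral_pd_eq_zero (i : Fin n) {F : Euc n → ℝ} (hF : ContDiff ℝ 1 F)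
    (hc : HasCompactSupport F) : ∫ x, pd i F x = 0 := by
  have hi : Integrable (pd i F) :=
    (contDiff_pd (k := 0) i hF (by norm_num)).continuous.integrable_of_hasCompactSupport (hc.pd i)
  have := integral_mul_fderiv_eq_neg_fderiv_mul_of_integrable (μ := (volume : Measure (Euc n)))
    (f := fun _ => (1 : ℝ)) (g := F) (v := EuclideanSpace.single i 1) (by simp)
    (by simp only [one_mul]; exact hi) (by simpa using hF.continuous.integrable_of_hasCompactSupport hc)
    (fun x _ => differentiableAt_const _)
    (fun x _ => hF.contDiffAt.differentiableAt (by norm_num))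
  simpa [pd] using this

lemma contDiff_mul_of_tsupport {m : WithTop ℕ∞} {f φ : Euc n → ℝ} (hφ : ContDiff ℝ m φ)
    (hf : ∀ x ∈ tsupport φ, ContDiffAt ℝ m f x) : ContDiff ℝ m fun x => f x * φ x := by
  refine contDiff_iff_contDiffAt.2 fun x => ?_
  by_cases hx : x ∈ tsupport φ
  · exact (hf x hx).mul hφ.contDiffAt
  · have : (fun x => f x * φ x) =ᶠ[𝓝 x] fun _ => 0 := by
      filter_upwards [notMem_tsupport_iff_eventuallyEq.1 hx] with y hy
      simp [hy]
    exact contDiffAt_const.congr_of_eventuallyEq this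

lemma continuous_mul_of_tsupport {f φ : Euc n → ℝ} (hφ : Continuous φ)
    (hf : ∀ x ∈ tsupport φ, ContinuousAt f x) : Continuous fun x => f x * φ x := by
  refine continuous_iff_continuousAt.2 fun x => ?_
  by_cases hx : x ∈ tsupport φ
  · exact (hf x hx).mul hφ.continuousAt
  · have : (fun x => f x * φ x) =ᶠ[𝓝 x] fun _ => 0 := by
      filter_upwards [notMem_tsupport_iff_eventuallyEq.1 hx] with y hy
      simp [hy]
    exact continuousAt_const.congr this.symm

lemma integrable_mul_of_tsupport {f φ : Euc n → ℝ} (hφ : Continuous φ)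
    (hc : HasCompactSupport φ) (hf : ∀ x ∈ tsupport φ, ContinuousAt f x) :
    Integrable fun x => f x * φ x :=
  (continuous_mul_of_tsupport hφ hf).integrable_of_hasCompactSupport hc.mul_left

lemma integral_mul_pd_eq (i : Fin n) {f φ : Euc n → ℝ} (hφ : ContDiff ℝ 1 φ)
    (hc : HasCompactSupport φ) (hf : ∀ x ∈ tsupport φ, ContDiffAt ℝ 1 f x) :
    ∫ x, f x * pd i φ x = -∫ x, pd i f x * φ x := by
  have i1 : Integrable fun x => f x * pd i φ x :=
    integrable_mul_of_tsupport (contDiff_pd (k := 0) i hφ (by norm_num)).continuous (hc.pd i)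
      fun x hx => (hf x (tsupport_pd_subset i φ hx)).continuousAt
  have i2 : Integrable fun x => pd i f x * φ x :=
    integrable_mul_of_tsupport hφ.continuous hc
      fun x hx => (contDiffAt_pd (k := 0) i (hf x hx) (by norm_num)).continuousAt
  have hF : ContDiff ℝ 1 fun x => f x * φ x := contDiff_mul_of_tsupport hφ hf
  have h := integral_pd_eq_zero i hF hc.mul_left
  have e : ∀ x, pd i (fun x => f x * φ x) x = pd i f x * φ x + f x * pd i φ x := by
    intro x
    by_cases hx : x ∈ tsupport φ
    · exact pd_mul i ((hf x hx).differentiableAt (by norm_num))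
        (hφ.contDiffAt.differentiableAt (by norm_num))
    · have h0 := notMem_tsupport_iff_eventuallyEq.1 hx
      have h1 : (fun x => f x * φ x) =ᶠ[𝓝 x] fun _ => 0 := by
        filter_upwards [h0] with y hy
        simp [hy]
      have h2 : pd i φ x = 0 := (pd_congr i h0).trans (pd_const i 0)
      rw [pd_congr i h1, pd_const, h2, h0.self_of_nhds]
      simp
  simp only [e] at h
  rw [integral_add i2 i1] at h
  linarith

lemma isOpen_punctured_ball : IsOpen (ball (0 : Euc n) 1 \ {0}) :=
  isOpen_ball.sdiff isClosed_singleton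

lemma IsGreenPole.contDiffAt {B : Euc n → Euc n} {g : Euc n → ℝ} (hg : IsGreenPole B 0 g)
    {x : Euc n} (hx : x ∈ ball (0 : Euc n) 1 \ {0}) : ContDiffAt ℝ 3 g x :=
  hg.2.1.contDiffAt (isOpen_punctured_ball.mem_nhds hx)

lemma IsGreenPole.weak_eq {B : Euc n → Euc n} {g : Euc n → ℝ} (hg : IsGreenPole B 0 g)
    {φ : Euc n → ℝ} (hφ : ContDiff ℝ (⊤ : ℕ∞) φ) (hc : HasCompactSupport φ)
    (hs : tsupport φ ⊆ ball 0 1) :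
    ∫ x, (∑ i, pd i g x * pd i φ x + (∑ i, B x i * pd i g x) * φ x) = φ 0 := by
  have h := hg.2.2.2.2.2 φ hφ hc hs
  simp only [inner_gradient_eq_sum_pd, gradient_apply_eq_pd] at h
  rw [← h, setIntegral_eq_integral_of_forall_compl_eq_zero]
  intro x hx
  have hx' : x ∉ tsupport φ := fun h' => hx (hs h')
  have h2 : ∀ i, pd i φ x = 0 := fun i =>
    (pd_congr i (notMem_tsupport_iff_eventuallyEq.1 hx')).trans (pd_const i 0)
  simp [h2, image_eq_zero_of_notMem_tsupport hx']

theorem IsGreenPole.lapl_eq {B : Euc n → Euc n} {g : Euc n → ℝ}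
    (hB : ContDiffOn ℝ 1 B (ball 0 1)) (hg : IsGreenPole B 0 g) :
    ∀ x ∈ ball (0 : Euc n) 1 \ {0}, lapl g x = ∑ i, B x i * pd i g x := by
  set U : Set (Euc n) := ball (0 : Euc n) 1 \ {0} with hU
  have hUo : IsOpen U := isOpen_punctured_ball
  set f : Euc n → ℝ := fun x => ∑ i, B x i * pd i g x - lapl g x with hf
  have c1 : ∀ i, ∀ x ∈ U, ContDiffAt ℝ 2 (pd i g) x := fun i x hx =>
    contDiffAt_pd i (hg.contDiffAt hx) (by norm_num)
  have c2 : ∀ i j, ∀ x ∈ U, ContinuousAt (pd j (pd i g)) x := fun i j x hx =>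
    (contDiffAt_pd (k := 1) j (c1 i x hx) (by norm_num)).continuousAt
  have cB : ∀ i, ∀ x ∈ U, ContinuousAt (fun y => B y i) x := fun i x hx =>
    (EuclideanSpace.proj i : Euc n →L[ℝ] ℝ).continuous.continuousAt.comp
      (hB.contDiffAt (isOpen_ball.mem_nhds hx.1)).continuousAt
  have cBg : ∀ x ∈ U, ContinuousAt (fun x => ∑ i, B x i * pd i g x) x := fun x hx =>
    tendsto_finsetSum _ fun i _ => (cB i x hx).mul (c1 i x hx).continuousAt
  have clap : ∀ x ∈ U, ContinuousAt (lapl g) x := fun x hx =>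
    tendsto_finsetSum _ fun i _ => c2 i i x hx
  have cf : ContinuousOn f U := fun x hx =>
    ((cBg x hx).sub (clap x hx)).continuousWithinAt
  have hae : ∀ᵐ x : Euc n, x ∈ U → f x = 0 := by
    refine hUo.ae_eq_zero_of_integral_contDiff_smul_eq_zero
      (cf.locallyIntegrableOn hUo.measurableSet) fun φ hφ hc hs => ?_
    have h0 : φ 0 = 0 := image_eq_zero_of_notMem_tsupport fun h => (hs h).2 rfl
    have hφ1 : ContDiff ℝ 1 φ := hφ.of_le (by exact_mod_cast le_top)
    have hw := hg.weak_eq hφ hc (hs.trans sdiff_subset)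
    have i1 : ∀ i, Integrable fun x => pd i g x * pd i φ x := fun i =>
      integrable_mul_of_tsupport (contDiff_pd (k := 0) i hφ1 (by norm_num)).continuous (hc.pd i)
        fun x hx => (c1 i x (hs (tsupport_pd_subset i φ hx))).continuousAt
    have i2 : Integrable fun x => (∑ i, B x i * pd i g x) * φ x :=
      integrable_mul_of_tsupport hφ.continuous hc fun x hx => cBg x (hs hx)
    have i3 : ∀ i, Integrable fun x => pd i (pd i g) x * φ x := fun i =>
      integrable_mul_of_tsupport hφ.continuous hc fun x hx => c2 i i x (hs hx)
    rw [integral_add (integrable_finsetSum _ fun i _ => i1 i) i2,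
      integral_finsetSum _ fun i _ => i1 i, h0] at hw
    have e : ∀ i, ∫ x, pd i g x * pd i φ x = -∫ x, pd i (pd i g) x * φ x := fun i =>
      integral_mul_pd_eq i hφ1 hc fun x hx => (c1 i x (hs hx)).of_le (by norm_num)
    simp only [e, Finset.sum_neg_distrib] at hw
    rw [← integral_finsetSum _ fun i _ => i3 i] at hw
    have e2 : ∀ x, φ x • f x =
        (∑ i, B x i * pd i g x) * φ x - ∑ i, pd i (pd i g) x * φ x := by
      intro x
      simp only [hf, lapl, smul_eq_mul, ← Finset.sum_mul]; ring
    simp only [e2]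
    rw [integral_sub i2 (integrable_finsetSum _ fun i _ => i3 i)]
    linarith
  intro x hx
  have hz : f x = 0 := by
    by_contra hne
    have hev : ∀ᶠ y in 𝓝 x, f y ≠ 0 ∧ y ∈ U :=
      ((cf.continuousAt (hUo.mem_nhds hx)).eventually_ne hne).and (hUo.mem_nhds hx)
    obtain ⟨V, hV, hVo, hxV⟩ := _root_.eventually_nhds_iff.1 hev
    have hpos : 0 < volume V := hVo.measure_pos volume ⟨x, hxV⟩
    refine hpos.ne' (measure_mono_null (fun y hy => ?_) (ae_iff.1 hae))
    simp only [mem_ofPred_eq, Classical.not_imp]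
    exact ⟨(hV y hy).2, (hV y hy).1⟩
  simp only [hf] at hz
  linarith

lemma lapl_log_eq {B : Euc n → Euc n} {g : Euc n → ℝ} {x : Euc n} (hg : ContDiffAt ℝ 2 g x)
    (hpos : 0 < g x) (heq : lapl g x = ∑ i, B x i * pd i g x) :
    lapl (fun y => Real.log (g y)) x = ∑ i, B x i * pd i (fun y => Real.log (g y)) x
      - ∑ i, pd i (fun y => Real.log (g y)) x ^ 2 := by
  have h1 : ∀ i, pd i (fun y => Real.log (g y)) x = (g x)⁻¹ * pd i g x := fun i =>
    pd_comp i (Real.hasDerivAt_log hpos.ne') (hg.differentiableAt (by norm_num))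
  have h2 : ∀ i, pd i (pd i fun y => Real.log (g y)) x =
      -(g x ^ 2)⁻¹ * pd i g x ^ 2 + (g x)⁻¹ * pd i (pd i g) x := fun i => by
    refine pd_pd_comp i (φ' := fun s => s⁻¹) ?_ (hasDerivAt_inv hpos.ne') hg
    filter_upwards [eventually_ne_nhds hpos.ne'] with s hs using Real.hasDerivAt_log hs
  simp only [lapl] at heq ⊢
  simp only [h1, h2, Finset.sum_add_distrib, ← Finset.mul_sum, heq, mul_pow]
  have h3 : ∑ i, B x i * ((g x)⁻¹ * pd i g x) = (g x)⁻¹ * ∑ i, B x i * pd i g x := by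
    rw [Finset.mul_sum]
    exact Finset.sum_congr rfl fun i _ => by ring
  rw [h3]
  ring

end PointwiseEquation

/-! ### Harnack inequality near the pole -/

section Harnack

variable {n : ℕ}

lemma IsGreenPole.exists_norm_gradient_log_le (hn : 1 ≤ n) {B : Euc n → Euc n} {g : Euc n → ℝ}
    (hB : ContDiffOn ℝ 1 B (ball 0 1)) (hg : IsGreenPole B 0 g) :
    ∃ ρ : ℝ, 0 < ρ ∧ ρ ≤ 1 / 4 ∧ ∀ x : Euc n, x ≠ 0 → ‖x‖ < ρ →
      ‖x‖ * ‖gradient (fun y => Real.log (g y)) x‖ ≤ 100 * n := by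
  have hsub : closedBall (0 : Euc n) (1 / 2) ⊆ ball 0 1 := closedBall_subset_ball (by norm_num)
  obtain ⟨K₁, hK₁⟩ := (isCompact_closedBall (0 : Euc n) (1 / 2)).exists_bound_of_continuousOn
    (hB.continuousOn.mono hsub)
  obtain ⟨K₂, hK₂⟩ := (isCompact_closedBall (0 : Euc n) (1 / 2)).exists_bound_of_continuousOn
    ((hB.continuousOn_fderiv_of_isOpen isOpen_ball le_rfl).mono hsub)
  set K := max 1 (max K₁ K₂)
  have hK1 : 1 ≤ K := le_max_left _ _
  have hK0 : 0 < K := by linarith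
  have hpde := hg.lapl_eq hB
  refine ⟨min (1 / 4) (1 / K), by positivity, min_le_left _ _, fun x hx0 hxρ => ?_⟩
  have hx : 0 < ‖x‖ := norm_pos_iff.2 hx0
  have hx4 : ‖x‖ < 1 / 4 := hxρ.trans_le (min_le_left _ _)
  have hxK : ‖x‖ * K ≤ 1 := by
    have := hxρ.trans_le (min_le_right _ _)
    rw [lt_div_iff₀ hK0] at this
    exact this.le
  have hmem : ∀ y ∈ closedBall x (‖x‖ / 2), y ∈ closedBall (0 : Euc n) (1 / 2) ∧
      y ∈ ball (0 : Euc n) 1 \ {0} := by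
    intro y hy
    rw [mem_closedBall, dist_eq_norm] at hy
    have h1 : ‖y‖ ≤ ‖y - x‖ + ‖x‖ := by simpa using norm_add_le (y - x) x
    have h2 : y ≠ 0 := by
      rintro rfl
      rw [zero_sub, norm_neg] at hy
      linarith
    refine ⟨by rw [mem_closedBall_zero_iff]; linarith, ?_, h2⟩
    rw [mem_ball_zero_iff]; linarith
  have key := norm_gradient_le_of_lapl_eq hn (u := fun y => Real.log (g y)) (B := B) (x₀ := x)
    (R := ‖x‖ / 2) (by positivity)
    (fun y hy => (hg.contDiffAt (hmem y hy).2).log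
      (hg.1 y (hmem y hy).2.1 (hmem y hy).2.2).ne')
    (fun y hy => (hB.contDiffAt (isOpen_ball.mem_nhds
      (hmem y (ball_subset_closedBall hy)).2.1)).differentiableAt (by norm_num))
    (fun y hy => ?_) (fun y hy => ?_) (fun y hy => ?_)
  · linarith
  · have h := hK₁ y (hmem y (ball_subset_closedBall hy)).1
    have : ‖B y‖ ≤ K := h.trans ((le_max_left _ _).trans (le_max_right _ _))
    have h0 := norm_nonneg (B y)
    nlinarith
  · have h := hK₂ y (hmem y (ball_subset_closedBall hy)).1
    have : ‖fderiv ℝ B y‖ ≤ K := h.trans ((le_max_right _ _).trans (le_max_right _ _))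
    calc (‖x‖ / 2) ^ 2 * ‖fderiv ℝ B y‖ ≤ ‖x‖ * K := by
          gcongr; nlinarith
      _ ≤ 1 := hxK
  · have hy' := (hmem y (ball_subset_closedBall hy)).2
    exact lapl_log_eq ((hg.contDiffAt hy').of_le (by norm_num)) (hg.1 y hy'.1 hy'.2)
      (hpde y hy')

lemma half_le_norm_of_mem_segment {p q v : Euc n} {m : ℝ} (hm : 0 ≤ m) (hpq : ⟪p, q⟫ = 0)
    (hp : m ≤ ‖p‖) (hq : m ≤ ‖q‖) (hv : v ∈ segment ℝ p q) : m / 2 ≤ ‖v‖ := by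
  obtain ⟨a, b, ha, hb, hab, rfl⟩ := hv
  have e : ‖a • p + b • q‖ ^ 2 = a ^ 2 * ‖p‖ ^ 2 + b ^ 2 * ‖q‖ ^ 2 := by
    rw [norm_add_sq_real, norm_smul, norm_smul, real_inner_smul_left, real_inner_smul_right, hpq]
    simp [mul_pow]
  have h1 : a ^ 2 * m ^ 2 ≤ a ^ 2 * ‖p‖ ^ 2 := by gcongr
  have h2 : b ^ 2 * m ^ 2 ≤ b ^ 2 * ‖q‖ ^ 2 := by gcongr
  have h3 : 1 / 4 ≤ a ^ 2 + b ^ 2 := by nlinarith [sq_nonneg (a - b)]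
  refine le_of_sq_le_sq ?_ (norm_nonneg _)
  nlinarith [sq_nonneg m]

lemma exists_orthogonal_of_norm (hn : 3 ≤ n) (x y : Euc n) (r : ℝ) (hr : 0 ≤ r) :
    ∃ z : Euc n, ‖z‖ = r ∧ ⟪x, z⟫ = 0 ∧ ⟪y, z⟫ = 0 := by
  set S : Submodule ℝ (Euc n) := Submodule.span ℝ {x, y}
  have hS : Sᗮ ≠ ⊥ := by
    intro h
    have htop : S = ⊤ := by rwa [Submodule.orthogonal_eq_bot_iff] at h
    have h1 : Module.finrank ℝ S ≤ 2 := by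
      have := finrank_span_finset_le_card (R := ℝ) ({x, y} : Finset (Euc n))
      simp only [Finset.coe_insert, Finset.coe_singleton] at this
      exact this.trans Finset.card_le_two
    rw [htop, finrank_top, finrank_euclideanSpace, Fintype.card_fin] at h1
    omega
  obtain ⟨z, hz, hz0⟩ := Submodule.exists_mem_ne_zero_of_ne_bot hS
  have hzn : ‖z‖ ≠ 0 := norm_ne_zero_iff.2 hz0
  have hx : ⟪x, z⟫ = 0 := (Submodule.mem_orthogonal S z).1 hz x (Submodule.subset_span (by simp))
  have hy : ⟪y, z⟫ = 0 := (Submodule.mem_orthogonal S z).1 hz y (Submodule.subset_span (by simp))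
  refine ⟨(r / ‖z‖) • z, ?_, ?_, ?_⟩
  · rw [norm_smul, Real.norm_of_nonneg (by positivity)]
    field_simp
  · rw [real_inner_smul_right, hx, mul_zero]
  · rw [real_inner_smul_right, hy, mul_zero]

/-- A function whose gradient is `O(1/|x|)` has bounded oscillation on dyadic annuli. -/
lemma abs_sub_le_of_norm_gradient_le (hn : 3 ≤ n) {u : Euc n → ℝ} {ρ C : ℝ} (hC : 0 ≤ C)
    (hd : ∀ x : Euc n, x ≠ 0 → ‖x‖ < ρ → DifferentiableAt ℝ u x)
    (hu : ∀ x : Euc n, x ≠ 0 → ‖x‖ < ρ → ‖x‖ * ‖gradient u x‖ ≤ C) {x y : Euc n}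
    (hx : x ≠ 0) (hxρ : ‖x‖ < ρ) (hyρ : ‖y‖ < ρ) (hxy : ‖x‖ ≤ 2 * ‖y‖) (hyx : ‖y‖ ≤ 2 * ‖x‖) :
    |u x - u y| ≤ 24 * C := by
  have hx0 : 0 < ‖x‖ := norm_pos_iff.2 hx
  set m := ‖x‖ / 2 with hm
  have hm0 : 0 < m := by positivity
  have key : ∀ p q : Euc n, ⟪p, q⟫ = 0 → m ≤ ‖p‖ → m ≤ ‖q‖ → ‖p‖ + ‖q‖ ≤ 6 * m → ‖p‖ < ρ →
      ‖q‖ < ρ → |u p - u q| ≤ 12 * C := by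
    intro p q hpq hp hq hs hpρ hqρ
    have hseg : ∀ v ∈ segment ℝ p q, v ≠ 0 ∧ ‖v‖ < ρ ∧ m / 2 ≤ ‖v‖ := by
      intro v hv
      have h1 := half_le_norm_of_mem_segment hm0.le hpq hp hq hv
      refine ⟨norm_pos_iff.1 (by linarith), ?_, h1⟩
      have := (convex_ball (0 : Euc n) ρ).segment_subset (mem_ball_zero_iff.2 hpρ)
        (mem_ball_zero_iff.2 hqρ) hv
      exact mem_ball_zero_iff.1 this
    have h := Convex.norm_image_sub_le_of_norm_fderiv_le (𝕜 := ℝ) (f := u) (C := 2 * C / m)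
      (s := segment ℝ p q) (x := q) (y := p)
      (fun v hv => hd v (hseg v hv).1 (hseg v hv).2.1)
      (fun v hv => ?_) (convex_segment p q) (right_mem_segment ℝ p q) (left_mem_segment ℝ p q)
    · rw [Real.norm_eq_abs] at h
      calc |u p - u q| ≤ 2 * C / m * ‖p - q‖ := h
        _ ≤ 2 * C / m * (6 * m) := by
          gcongr
          exact (norm_sub_le p q).trans hs
        _ = 12 * C := by field_simp; ring
    · obtain ⟨h1, h2, h3⟩ := hseg v hv
      rw [← norm_gradient_eq_norm_fderiv, le_div_iff₀ hm0]
      have := hu v h1 h2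
      nlinarith [norm_nonneg (gradient u v)]
  obtain ⟨z, hz, hxz, hyz⟩ := exists_orthogonal_of_norm hn x y ‖x‖ hx0.le
  have h1 := key x z hxz (by linarith) (by linarith) (by linarith) hxρ (hz ▸ hxρ)
  have h2 := key y z hyz (by linarith) (by linarith) (by linarith) hyρ (hz ▸ hxρ)
  have h3 : u x - u y = (u x - u z) - (u y - u z) := by ring
  rw [h3]
  exact (abs_sub _ _).trans (by linarith)

theorem IsGreenPole.harnack (hn : 3 ≤ n) {B : Euc n → Euc n} {g : Euc n → ℝ}
    (hB : ContDiffOn ℝ 1 B (ball 0 1)) (hg : IsGreenPole B 0 g) :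
    ∃ ρ : ℝ, 0 < ρ ∧ ρ ≤ 1 / 4 ∧ ∀ x y : Euc n, x ≠ 0 → y ≠ 0 → ‖x‖ < ρ → ‖y‖ < ρ →
      ‖x‖ ≤ 2 * ‖y‖ → ‖y‖ ≤ 2 * ‖x‖ → g x ≤ Real.exp (2400 * n) * g y := by
  obtain ⟨ρ, hρ, hρ4, hgrad⟩ := hg.exists_norm_gradient_log_le (by omega) hB
  have hmem : ∀ x : Euc n, x ≠ 0 → ‖x‖ < ρ → x ∈ ball (0 : Euc n) 1 \ {0} := fun x h0 hx =>
    ⟨mem_ball_zero_iff.2 (by linarith), h0⟩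
  have hpos : ∀ x : Euc n, x ≠ 0 → ‖x‖ < ρ → 0 < g x := fun x h0 hx =>
    hg.1 x (hmem x h0 hx).1 h0
  refine ⟨ρ, hρ, hρ4, fun x y hx hy hxρ hyρ hxy hyx => ?_⟩
  have h := abs_sub_le_of_norm_gradient_le hn (C := 100 * n) (by positivity)
    (fun v hv hvρ => ((hg.contDiffAt (hmem v hv hvρ)).log (hpos v hv hvρ).ne').differentiableAt
      (by norm_num)) hgrad hx hxρ hyρ hxy hyx
  have h2 : Real.log (g x) ≤ 2400 * n + Real.log (g y) := by
    have := le_of_abs_le h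
    linarith
  calc g x = Real.exp (Real.log (g x)) := (Real.exp_log (hpos x hx hxρ)).symm
    _ ≤ Real.exp (2400 * n + Real.log (g y)) := Real.exp_le_exp.2 h2
    _ = _ := by rw [Real.exp_add, Real.exp_log (hpos y hy hyρ)]

end Harnack

/-! ### The radial fundamental profile -/

section Profile

/-- `|x|^(2-n)`, written as a power of `|x|²`. -/
def fund (n : ℕ) (x : Euc n) : ℝ := (‖x - 0‖ ^ 2) ^ (-((n : ℝ) - 2) / 2)

variable {n : ℕ} {x y : Euc n}

lemma fund_pos (hx : x ≠ 0) : 0 < fund n x := by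
  have : 0 < ‖x - 0‖ := by simpa using hx
  unfold fund; positivity

lemma fund_zero (hn : 3 ≤ n) : fund n 0 = 0 := by
  have : (3 : ℝ) ≤ n := by exact_mod_cast hn
  simp only [fund, sub_zero, norm_zero]
  rw [zero_pow (by norm_num), Real.zero_rpow (by linarith)]

lemma fund_lt_fund (hn : 3 ≤ n) (hx : x ≠ 0) (hxy : ‖x‖ < ‖y‖) : fund n y < fund n x := by
  have : (3 : ℝ) ≤ n := by exact_mod_cast hn
  have hx0 : 0 < ‖x‖ := norm_pos_iff.2 hx
  simp only [fund, sub_zero]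
  exact Real.rpow_lt_rpow_of_neg (by positivity) (by gcongr) (by linarith)

lemma two_mul_fund_lt (hn : 3 ≤ n) (hx : x ≠ 0) (hxy : 2 * ‖x‖ < ‖y‖) :
    2 * fund n y < fund n x := by
  have hn' : (3 : ℝ) ≤ n := by exact_mod_cast hn
  have h2 : 2 * fund n ((2 : ℝ) • x) ≤ fund n x := by
    simp only [fund, sub_zero, norm_smul, mul_pow, Real.norm_ofNat]
    rw [Real.mul_rpow (by positivity) (by positivity)]
    have h4 : ((2 : ℝ) ^ 2) ^ (-((n : ℝ) - 2) / 2) ≤ 1 / 2 := by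
      calc ((2 : ℝ) ^ 2) ^ (-((n : ℝ) - 2) / 2) = 2 ^ (-((n : ℝ) - 2)) := by
            rw [← Real.rpow_natCast, ← Real.rpow_mul (by norm_num)]
            congr 1; push_cast; ring
        _ ≤ 2 ^ (-1 : ℝ) := Real.rpow_le_rpow_of_exponent_le (by norm_num) (by linarith)
        _ = 1 / 2 := by rw [Real.rpow_neg_one]; norm_num
    have h0 : 0 ≤ (‖x‖ ^ 2) ^ (-((n : ℝ) - 2) / 2) := by positivity
    nlinarith
  have h3 : fund n y < fund n ((2 : ℝ) • x) :=
    fund_lt_fund hn (by simpa using hx) (by simpa [norm_smul] using hxy)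
  linarith

lemma exists_lt_fund (hn : 3 ≤ n) (N : ℝ) :
    ∃ ρ > 0, ∀ x : Euc n, x ≠ 0 → ‖x‖ < ρ → N < fund n x := by
  have hn' : (3 : ℝ) ≤ n := by exact_mod_cast hn
  set α : ℝ := -((n : ℝ) - 2) / 2 with hα
  have hα0 : α < 0 := by rw [hα]; linarith
  set N' := max N 1
  have hN' : 0 < N' := by positivity
  refine ⟨√(N' ^ α⁻¹), by positivity, fun x hx hxρ => (le_max_left N 1).trans_lt ?_⟩
  have hx0 : 0 < ‖x‖ := norm_pos_iff.2 hx
  have h1 : ‖x‖ ^ 2 < N' ^ α⁻¹ := by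
    rw [← Real.sq_sqrt (show 0 ≤ N' ^ α⁻¹ by positivity)]
    gcongr
  have h2 := Real.rpow_lt_rpow_of_neg (by positivity) h1 hα0
  rw [Real.rpow_inv_rpow hN'.le hα0.ne] at h2
  simp only [fund, sub_zero]
  exact h2

lemma contDiffAt_fund {m : WithTop ℕ∞} (hx : x ≠ 0) : ContDiffAt ℝ m (fund n) x := by
  have h : ‖x - 0‖ ^ 2 ≠ 0 := by simpa using hx
  exact (contDiff_norm_sub_sq 0).contDiffAt.rpow_const_of_ne h

lemma pd_fund (hx : x ≠ 0) (i : Fin n) :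
    pd i (fund n) x = -((n : ℝ) - 2) * (‖x‖ ^ 2) ^ (-((n : ℝ) - 2) / 2 - 1) * x i := by
  have h : ‖x - 0‖ ^ 2 ≠ 0 := by simpa using hx
  have := pd_comp i (f := fun y : Euc n => ‖y - 0‖ ^ 2)
    (Real.hasDerivAt_rpow_const (p := -((n : ℝ) - 2) / 2) (Or.inl h))
    ((contDiff_norm_sub_sq (m := 1) 0).contDiffAt.differentiableAt (by norm_num))
  unfold fund
  rw [this, pd_norm_sub_sq]
  simp only [sub_zero, PiLp.zero_apply]
  ring

lemma lapl_fund (hx : x ≠ 0) : lapl (fund n) x = 0 := by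
  have h : ‖x - 0‖ ^ 2 ≠ 0 := by simpa using hx
  have hpos : 0 < ‖x - 0‖ ^ 2 := lt_of_le_of_ne (by positivity) h.symm
  set α : ℝ := -((n : ℝ) - 2) / 2 with hα
  have key : ∀ i, pd i (pd i (fund n)) x = α * ((α - 1) * (‖x - 0‖ ^ 2) ^ (α - 1 - 1)) *
      (2 * (x i - (0 : Euc n) i)) ^ 2 + α * (‖x - 0‖ ^ 2) ^ (α - 1) * 2 := by
    intro i
    have := pd_pd_comp i (f := fun y : Euc n => ‖y - 0‖ ^ 2) (x := x)
      (φ := fun s => s ^ α) (φ' := fun s => α * s ^ (α - 1))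
      (φ'' := α * ((α - 1) * (‖x - 0‖ ^ 2) ^ (α - 1 - 1)))
      (by filter_upwards [eventually_ne_nhds h] with s hs
          using Real.hasDerivAt_rpow_const (Or.inl hs))
      ((Real.hasDerivAt_rpow_const (Or.inl h)).const_mul α)
      (contDiff_norm_sub_sq 0).contDiffAt
    rw [pd_pd_norm_sub_sq, pd_norm_sub_sq] at this
    exact this
  simp only [lapl, key, Finset.sum_add_distrib, ← Finset.mul_sum, mul_pow, Finset.sum_const,
    Finset.card_univ, Fintype.card_fin, nsmul_eq_mul]
  have hs : ∑ i, (x i - (0 : Euc n) i) ^ 2 = ‖x - 0‖ ^ 2 := by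
    rw [EuclideanSpace.real_norm_sq_eq]; simp
  have hp : (‖x - 0‖ ^ 2) ^ (α - 1) = (‖x - 0‖ ^ 2) ^ (α - 1 - 1) * ‖x - 0‖ ^ 2 := by
    conv_rhs => rw [← Real.rpow_add_one h]
    congr 1; ring
  have hn2 : (n : ℝ) = 2 - 2 * α := by rw [hα]; ring
  rw [hs, hp, hn2]
  ring

end Profile

/-! ### A smooth convex truncation of the identity -/

/-- `P` is a smooth convex function with first and second derivatives `P'`, `P''` which vanishes
on `(-∞, 1]` and equals `s - c` on `[2, ∞)`. -/
structure IsTruncation (P P' P'' : ℝ → ℝ) (c : ℝ) : Prop where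
  one_le : 1 ≤ c
  le_two : c ≤ 2
  contDiff : ContDiff ℝ (⊤ : ℕ∞) P
  hasDerivAt : ∀ s, HasDerivAt P (P' s) s
  hasDerivAt_deriv : ∀ s, HasDerivAt P' (P'' s) s
  continuous_deriv_deriv : Continuous P''
  deriv_deriv_nonneg : ∀ s, 0 ≤ P'' s
  deriv_deriv_of_lt_one : ∀ s, s < 1 → P'' s = 0
  deriv_deriv_of_two_lt : ∀ s, 2 < s → P'' s = 0
  of_le_one : ∀ s, s ≤ 1 → P s = 0
  of_two_le : ∀ s, 2 ≤ s → P s = s - c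
  bounds : ∀ s, 0 ≤ s → 0 ≤ P s ∧ P s ≤ s

lemma exists_isTruncation : ∃ (P P' P'' : ℝ → ℝ) (c : ℝ), IsTruncation P P' P'' c := by
  set st := Real.smoothTransition with hst
  have hsm : ContDiff ℝ (⊤ : ℕ∞) fun s : ℝ => st (s - 1) :=
    Real.smoothTransition.contDiff.comp (contDiff_id.sub contDiff_const)
  have hcont : Continuous fun s : ℝ => st (s - 1) := hsm.continuous
  have hint : ∀ a b : ℝ, IntervalIntegrable (fun s : ℝ => st (s - 1)) volume a b :=
    fun a b => hcont.intervalIntegrable a b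
  have hle : ∀ s : ℝ, st (s - 1) ≤ 1 := fun s => Real.smoothTransition.le_one _
  have hnn : ∀ s : ℝ, 0 ≤ st (s - 1) := fun s => Real.smoothTransition.nonneg _
  have hz : ∀ s : ℝ, s ≤ 1 → st (s - 1) = 0 := fun s hs =>
    Real.smoothTransition.zero_of_nonpos (by linarith)
  have ho : ∀ s : ℝ, 2 ≤ s → st (s - 1) = 1 := fun s hs =>
    Real.smoothTransition.one_of_one_le (by linarith)
  have hmono : Monotone fun s : ℝ => st (s - 1) := fun a b hab =>
    Real.smoothTransition.monotone (by linarith)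
  set P : ℝ → ℝ := fun s => ∫ t in (1 : ℝ)..s, st (t - 1) with hP
  have hPd : ∀ s, HasDerivAt P (st (s - 1)) s := fun s =>
    intervalIntegral.integral_hasDerivAt_right (hint 1 s)
      (hcont.stronglyMeasurableAtFilter _ _) hcont.continuousAt
  have hdd : ∀ s, HasDerivAt (fun s : ℝ => st (s - 1)) (deriv (fun s : ℝ => st (s - 1)) s) s :=
    fun s => (hsm.differentiable (by simp) s).hasDerivAt
  have hP1 : ∀ s, s ≤ 1 → P s = 0 := by
    intro s hs
    have : EqOn (fun t : ℝ => st (t - 1)) (fun _ => 0) (uIcc 1 s) := by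
      intro t ht
      rw [uIcc_of_ge hs] at ht
      exact hz t ht.2
    rw [hP]
    simp only
    rw [intervalIntegral.integral_congr this]; simp
  have hPnn : ∀ s, 1 ≤ s → 0 ≤ P s := fun s hs =>
    intervalIntegral.integral_nonneg hs fun t _ => hnn t
  have hPle : ∀ s, 1 ≤ s → P s ≤ s - 1 := by
    intro s hs
    have := intervalIntegral.integral_mono_on hs (hint 1 s) (intervalIntegrable_const (c := (1 : ℝ)))
      fun t _ => hle t
    simp only [intervalIntegral.integral_const, smul_eq_mul, mul_one] at this
    exact this
  have hP2 : ∀ s, 2 ≤ s → P s = s - (2 - P 2) := by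
    intro s hs
    have h1 := intervalIntegral.integral_add_adjacent_intervals (hint 1 2) (hint 2 s)
    have : EqOn (fun t : ℝ => st (t - 1)) (fun _ => 1) (uIcc 2 s) := by
      intro t ht
      rw [uIcc_of_le hs] at ht
      exact ho t ht.1
    rw [intervalIntegral.integral_congr this] at h1
    simp only [intervalIntegral.integral_const, smul_eq_mul, mul_one] at h1
    simp only [hP]
    linarith
  refine ⟨P, fun s => st (s - 1), deriv fun s : ℝ => st (s - 1), 2 - P 2, ?_, ?_, ?_, hPd, hdd,
    hsm.continuous_deriv (by simp), fun s => hmono.deriv_nonneg, ?_, ?_, hP1, hP2, ?_⟩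
  · have := hPle 2 (by norm_num); linarith
  · have := hPnn 2 (by norm_num); linarith
  · rw [contDiff_infty_iff_deriv]
    refine ⟨fun s => (hPd s).differentiableAt, ?_⟩
    have : deriv P = fun s => st (s - 1) := funext fun s => (hPd s).deriv
    rw [this]; exact hsm
  · intro s hs
    have : (fun s : ℝ => st (s - 1)) =ᶠ[𝓝 s] fun _ => 0 := by
      filter_upwards [eventually_lt_nhds hs] with t ht using hz t ht.le
    rw [this.deriv_eq]; simp
  · intro s hs
    have : (fun s : ℝ => st (s - 1)) =ᶠ[𝓝 s] fun _ => 1 := by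
      filter_upwards [eventually_gt_nhds hs] with t ht using ho t ht.le
    rw [this.deriv_eq]; simp
  · intro s hs
    rcases le_total s 1 with h | h
    · rw [hP1 s h]; exact ⟨le_rfl, hs⟩
    · exact ⟨hPnn s h, (hPle s h).trans (by linarith)⟩

/-! ### The flux identity and the two-sided bound near the pole -/

section Flux

variable {n : ℕ} {P P' P'' : ℝ → ℝ} {c S T ρ : ℝ} {x : Euc n}

/-- The Laplacian of `S * P (fund / S)`, concentrated on the shell `S ≤ fund ≤ 2 * S`. -/
def shell (P'' : ℝ → ℝ) (S : ℝ) (x : Euc n) : ℝ :=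
  P'' (fund n x / S) / S * ∑ i, pd i (fund n) x ^ 2

/-- The difference `T * P (fund / T) - S * P (fund / S)`, extended smoothly across the origin. -/
def fluxTest (P : ℝ → ℝ) (c T S : ℝ) (x : Euc n) : ℝ :=
  if x = 0 then c * (S - T) else T * P (fund n x / T) - S * P (fund n x / S)

lemma shell_nonneg (hP : IsTruncation P P' P'' c) (hS : 0 < S) (x : Euc n) :
    0 ≤ shell P'' S x := by
  have := hP.deriv_deriv_nonneg (fund n x / S)
  unfold shell; positivity

lemma shell_eq_zero_of_fund_lt (hP : IsTruncation P P' P'' c) (hS : 0 < S)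
    (hx : fund n x < S) : shell P'' S x = 0 := by
  rw [shell, hP.deriv_deriv_of_lt_one _ ((div_lt_one hS).2 hx)]; simp

lemma shell_eq_zero_of_lt_fund (hP : IsTruncation P P' P'' c) (hS : 0 < S)
    (hx : 2 * S < fund n x) : shell P'' S x = 0 := by
  rw [shell, hP.deriv_deriv_of_two_lt _ ((lt_div_iff₀ hS).2 hx)]; simp

lemma shell_zero (hn : 3 ≤ n) (hP : IsTruncation P P' P'' c) (hS : 0 < S) :
    shell P'' S (0 : Euc n) = 0 :=
  shell_eq_zero_of_fund_lt hP hS (by rwa [fund_zero hn])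

lemma eventually_lt_fund (hn : 3 ≤ n) (N : ℝ) : ∀ᶠ x : Euc n in 𝓝 0, x ≠ 0 → N < fund n x := by
  obtain ⟨ρ, hρ, h⟩ := exists_lt_fund hn N
  filter_upwards [ball_mem_nhds (0 : Euc n) hρ] with x hx hx0
  exact h x hx0 (mem_ball_zero_iff.1 hx)

lemma shell_eventuallyEq_zero (hn : 3 ≤ n) (hP : IsTruncation P P' P'' c) (hS : 0 < S) :
    (shell P'' S : Euc n → ℝ) =ᶠ[𝓝 0] 0 := by
  filter_upwards [eventually_lt_fund hn (2 * S)] with x hx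
  rcases eq_or_ne x 0 with rfl | h0
  · exact shell_zero hn hP hS
  · exact shell_eq_zero_of_lt_fund hP hS (hx h0)

lemma continuous_shell (hn : 3 ≤ n) (hP : IsTruncation P P' P'' c) (hS : 0 < S) :
    Continuous (shell P'' S : Euc n → ℝ) := by
  refine continuous_iff_continuousAt.2 fun x => ?_
  rcases eq_or_ne x 0 with rfl | h0
  · exact continuousAt_const.congr (shell_eventuallyEq_zero hn hP hS).symm
  · have h1 : ContinuousAt (fund n) x := (contDiffAt_fund (m := 0) h0).continuousAt
    have h2 : ∀ i, ContinuousAt (pd i (fund n)) x := fun i =>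
      (contDiffAt_pd (k := 0) i (contDiffAt_fund (m := 1) h0) (by norm_num)).continuousAt
    exact ((hP.continuous_deriv_deriv.continuousAt.comp (h1.div_const S)).div_const S).mul
      (tendsto_finsetSum _ fun i _ => (h2 i).pow 2)

lemma tsupport_shell_subset (hn : 3 ≤ n) (hP : IsTruncation P P' P'' c) (hS : 0 < S)
    (hρ : ∀ x : Euc n, x ≠ 0 → S ≤ fund n x → ‖x‖ ≤ ρ) :
    tsupport (shell P'' S : Euc n → ℝ) ⊆ closedBall 0 ρ \ {0} := by
  intro x hx
  refine ⟨closure_minimal (fun y hy => ?_) isClosed_closedBall hx, fun h => ?_⟩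
  · rw [mem_closedBall_zero_iff]
    refine hρ y (fun h => hy (by rw [h, shell_zero hn hP hS])) ?_
    by_contra! h
    exact hy (shell_eq_zero_of_fund_lt hP hS h)
  · rw [mem_singleton_iff.1 h] at hx
    exact notMem_tsupport_iff_eventuallyEq.2 (shell_eventuallyEq_zero hn hP hS) hx

lemma hasCompactSupport_shell (hn : 3 ≤ n) (hP : IsTruncation P P' P'' c) (hS : 0 < S)
    (hρ : ∀ x : Euc n, x ≠ 0 → S ≤ fund n x → ‖x‖ ≤ ρ) :
    HasCompactSupport (shell P'' S : Euc n → ℝ) :=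
  HasCompactSupport.of_support_subset_isCompact (isCompact_closedBall 0 ρ)
    ((subset_tsupport _).trans ((tsupport_shell_subset hn hP hS hρ).trans sdiff_subset))

lemma lapl_truncation (hP : IsTruncation P P' P'' c) (hS : 0 < S) (hx : x ≠ 0) (i : Fin n) :
    pd i (pd i fun y => S * P (fund n y / S)) x =
      P'' (fund n x / S) / S * pd i (fund n) x ^ 2 + P' (fund n x / S) * pd i (pd i (fund n)) x := by
  have h1 : ∀ s, HasDerivAt (fun s => S * P (s / S)) (P' (s / S)) s := fun s => by
    have := ((hP.hasDerivAt (s / S)).comp s ((hasDerivAt_id s).div_const S)).const_mul S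
    simp only [Function.comp_def, id] at this
    exact this.congr_deriv (by field_simp)
  have h2 : ∀ s, HasDerivAt (fun s => P' (s / S)) (P'' (s / S) / S) s := fun s => by
    have := (hP.hasDerivAt_deriv (s / S)).comp s ((hasDerivAt_id s).div_const S)
    simp only [Function.comp_def, id] at this
    exact this.congr_deriv (by ring)
  exact pd_pd_comp i (f := fund n) (φ := fun s => S * P (s / S)) (Eventually.of_forall h1) (h2 _)
    (contDiffAt_fund hx)

lemma contDiffAt_truncation (hP : IsTruncation P P' P'' c) (S : ℝ) (hx : x ≠ 0) :
    ContDiffAt ℝ (⊤ : ℕ∞) (fun y => S * P (fund n y / S)) x :=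
  contDiffAt_const.mul (hP.contDiff.contDiffAt.comp x ((contDiffAt_fund hx).div_const S))

lemma fluxTest_eventuallyEq (hx : x ≠ 0) : (fluxTest P c T S : Euc n → ℝ) =ᶠ[𝓝 x]
    fun y => T * P (fund n y / T) - S * P (fund n y / S) := by
  filter_upwards [eventually_ne_nhds hx] with y hy
  simp [fluxTest, hy]

lemma fluxTest_eventuallyEq_const (hn : 3 ≤ n) (hP : IsTruncation P P' P'' c) (hT : 0 < T)
    (hTS : T ≤ S) : (fluxTest P c T S : Euc n → ℝ) =ᶠ[𝓝 0] fun _ => c * (S - T) := by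
  have hS := hT.trans_le hTS
  filter_upwards [eventually_lt_fund hn (2 * S)] with x hx
  by_cases h0 : x = 0
  · simp [fluxTest, h0]
  · have h := hx h0
    rw [fluxTest, if_neg h0, hP.of_two_le _ ((le_div_iff₀ hS).2 h.le),
      hP.of_two_le _ ((le_div_iff₀ hT).2 (by linarith))]
    field_simp
    ring

lemma contDiff_fluxTest (hn : 3 ≤ n) (hP : IsTruncation P P' P'' c) (hT : 0 < T)
    (hTS : T ≤ S) : ContDiff ℝ (⊤ : ℕ∞) (fluxTest P c T S : Euc n → ℝ) := by
  refine contDiff_iff_contDiffAt.2 fun x => ?_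
  rcases eq_or_ne x 0 with rfl | h0
  · exact contDiffAt_const.congr_of_eventuallyEq (fluxTest_eventuallyEq_const hn hP hT hTS)
  · exact ((contDiffAt_truncation hP T h0).sub (contDiffAt_truncation hP S h0)).congr_of_eventuallyEq
      (fluxTest_eventuallyEq h0)

lemma lapl_fluxTest (hn : 3 ≤ n) (hP : IsTruncation P P' P'' c) (hT : 0 < T)
    (hTS : T ≤ S) (x : Euc n) :
    lapl (fluxTest P c T S) x = shell P'' T x - shell P'' S x := by
  have hS := hT.trans_le hTS
  rcases eq_or_ne x 0 with rfl | h0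
  · rw [shell_zero hn hP hT, shell_zero hn hP hS, lapl, sub_zero]
    refine Finset.sum_eq_zero fun i _ => ?_
    have e := pd_eventuallyEq i (fluxTest_eventuallyEq_const (n := n) hn hP hT hTS)
    simp only [pd_congr i e, show pd i (fun _ : Euc n => c * (S - T)) = fun _ => 0 from
      funext fun _ => pd_const i _, pd_const]
  · have h1 : ∀ i, pd i (pd i (fluxTest P c T S)) x =
        pd i (pd i fun y => T * P (fund n y / T)) x
          - pd i (pd i fun y => S * P (fund n y / S)) x := by
      intro i
      have e : pd i (fluxTest P c T S) =ᶠ[𝓝 x] fun y => pd i (fun y => T * P (fund n y / T)) y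
          - pd i (fun y => S * P (fund n y / S)) y := by
        filter_upwards [(fluxTest_eventuallyEq (P := P) (c := c) (T := T) (S := S)
          h0).eventuallyEq_nhds, eventually_ne_nhds h0] with y hy hy0
        rw [pd_congr i hy]
        exact pd_sub i ((contDiffAt_truncation hP T hy0).differentiableAt (by simp))
          ((contDiffAt_truncation hP S hy0).differentiableAt (by simp))
      rw [pd_congr i e]
      exact pd_sub i
        ((contDiffAt_pd (k := 1) i ((contDiffAt_truncation hP T h0).of_le (m := 2)
          (WithTop.coe_le_coe.2 le_top)) (by norm_num)).differentiableAt (by norm_num))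
        ((contDiffAt_pd (k := 1) i ((contDiffAt_truncation hP S h0).of_le (m := 2)
          (WithTop.coe_le_coe.2 le_top)) (by norm_num)).differentiableAt (by norm_num))
    have h3 := lapl_fund h0
    rw [lapl] at h3 ⊢
    simp only [h1, lapl_truncation hP hT h0, lapl_truncation hP hS h0, Finset.sum_sub_distrib,
      Finset.sum_add_distrib, ← Finset.mul_sum, h3, shell]
    ring

lemma abs_fluxTest_le (hP : IsTruncation P P' P'' c) (hT : 0 < T) (hTS : T ≤ S) (x : Euc n) :
    |fluxTest P c T S x| ≤ 2 * S := by
  have hS := hT.trans_le hTS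
  have hc1 := hP.one_le
  have hc2 := hP.le_two
  have hc : 0 ≤ c * (S - T) ∧ c * (S - T) ≤ 2 * S := ⟨by nlinarith, by nlinarith⟩
  rw [abs_le, fluxTest]
  split_ifs with h0
  · exact ⟨by linarith, hc.2⟩
  · have hs := fund_pos h0
    rcases le_total (2 * S) (fund n x) with h | h
    · have e : T * (fund n x / T - c) - S * (fund n x / S - c) = c * (S - T) := by
        field_simp; ring
      rw [hP.of_two_le _ ((le_div_iff₀ hS).2 h),
        hP.of_two_le _ ((le_div_iff₀ hT).2 (by linarith)), e]
      exact ⟨by linarith, hc.2⟩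
    · obtain ⟨a1, a2⟩ := hP.bounds (fund n x / T) (by positivity)
      obtain ⟨b1, b2⟩ := hP.bounds (fund n x / S) (by positivity)
      rw [le_div_iff₀ hT] at a2
      rw [le_div_iff₀ hS] at b2
      constructor <;> nlinarith

lemma fluxTest_eq_zero (hP : IsTruncation P P' P'' c) (hT : 0 < T) (hTS : T ≤ S) (hx : x ≠ 0)
    (h : fund n x ≤ T) : fluxTest P c T S x = 0 := by
  rw [fluxTest, if_neg hx, hP.of_le_one _ ((div_le_one hT).2 h),
    hP.of_le_one _ ((div_le_one (hT.trans_le hTS)).2 (h.trans hTS))]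
  simp

lemma tsupport_fluxTest_subset (hP : IsTruncation P P' P'' c) (hT : 0 < T) (hTS : T ≤ S)
    (hρ0 : 0 ≤ ρ) (hρ : ∀ x : Euc n, x ≠ 0 → T ≤ fund n x → ‖x‖ ≤ ρ) :
    tsupport (fluxTest P c T S : Euc n → ℝ) ⊆ closedBall 0 ρ := by
  refine closure_minimal (fun y hy => ?_) isClosed_closedBall
  rw [mem_closedBall_zero_iff]
  rcases eq_or_ne y 0 with rfl | h0
  · simpa
  · refine hρ y h0 ?_
    by_contra! h
    exact hy (fluxTest_eq_zero hP hT hTS h0 h.le)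

lemma integral_shell_eq (hn : 3 ≤ n) (hP : IsTruncation P P' P'' c) (hT : 0 < T)
    (hTS : T ≤ S) (hρ0 : 0 ≤ ρ) (hρ : ∀ x : Euc n, x ≠ 0 → T ≤ fund n x → ‖x‖ ≤ ρ) :
    ∫ x : Euc n, shell P'' S x = ∫ x : Euc n, shell P'' T x := by
  have hS := hT.trans_le hTS
  set φ : Euc n → ℝ := fluxTest P c T S
  have hφ : ContDiff ℝ (⊤ : ℕ∞) φ := contDiff_fluxTest hn hP hT hTS
  have hts : tsupport φ ⊆ closedBall 0 ρ := tsupport_fluxTest_subset hP hT hTS hρ0 hρ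
  have hc : HasCompactSupport φ := HasCompactSupport.of_support_subset_isCompact
    (isCompact_closedBall 0 ρ) ((subset_tsupport _).trans hts)
  have hpd : ∀ i, ContDiff ℝ 1 (pd i φ) := fun i => contDiff_pd i hφ (WithTop.coe_le_coe.2 le_top)
  have iT : Integrable (shell P'' T : Euc n → ℝ) :=
    (continuous_shell hn hP hT).integrable_of_hasCompactSupport (hasCompactSupport_shell hn hP hT hρ)
  have iS : Integrable (shell P'' S : Euc n → ℝ) :=
    (continuous_shell hn hP hS).integrable_of_hasCompactSupport
    (hasCompactSupport_shell hn hP hS fun x h0 h => hρ x h0 (hTS.trans h))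
  have h1 : ∫ x, lapl φ x = 0 := by
    simp only [lapl]
    rw [integral_finsetSum _ fun i _ => (contDiff_pd (k := 0) i (hpd i)
      (by norm_num)).continuous.integrable_of_hasCompactSupport ((hc.pd i).pd i)]
    exact Finset.sum_eq_zero fun i _ => integral_pd_eq_zero i (hpd i) (hc.pd i)
  simp only [φ, lapl_fluxTest hn hP hT hTS] at h1
  rw [integral_sub iT iS] at h1
  linarith

end Flux

/-! ### Two-sided bound near the pole -/

section TwoSided

variable {n : ℕ} {P P' P'' : ℝ → ℝ} {c S T ρ : ℝ} {B : Euc n → Euc n} {g : Euc n → ℝ}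

lemma IsGreenPole.contDiffAt_of_norm_le (hg : IsGreenPole B 0 g) {x : Euc n} (hρ : ρ < 1)
    (hx : x ∈ closedBall (0 : Euc n) ρ \ {0}) : ContDiffAt ℝ 3 g x :=
  hg.contDiffAt ⟨closedBall_subset_ball hρ hx.1, hx.2⟩

lemma IsGreenPole.integrableOn_drift (hn : 3 ≤ n) (hB : ContDiffOn ℝ 1 B (ball 0 1))
    (hg : IsGreenPole B 0 g) :
    IntegrableOn (fun x => ∑ i, B x i * pd i g x) (closedBall 0 (1 / 2)) := by
  have : Nonempty (Fin n) := ⟨⟨0, by omega⟩⟩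
  have hsub : closedBall (0 : Euc n) (1 / 2) ⊆ ball 0 1 := closedBall_subset_ball (by norm_num)
  obtain ⟨K, hK⟩ := (isCompact_closedBall (0 : Euc n) (1 / 2)).exists_bound_of_continuousOn
    (hB.continuousOn.mono hsub)
  have hae : (closedBall (0 : Euc n) (1 / 2) \ {0} : Set (Euc n)) =ᵐ[volume]
      closedBall (0 : Euc n) (1 / 2) := sdiff_null_ae_eq_self (measure_singleton 0)
  rw [← integrableOn_congr_set_ae hae]
  have hms : MeasurableSet (closedBall (0 : Euc n) (1 / 2) \ {0}) :=
    isClosed_closedBall.measurableSet.diff (measurableSet_singleton 0)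
  have hcont : ContinuousOn (fun x => ∑ i, B x i * pd i g x) (closedBall 0 (1 / 2) \ {0}) := by
    intro x hx
    refine ContinuousAt.continuousWithinAt (tendsto_finsetSum _ fun i _ => ?_)
    have h1 : ContinuousAt (fun y => B y i) x :=
      (EuclideanSpace.proj i : Euc n →L[ℝ] ℝ).continuous.continuousAt.comp
        (hB.contDiffAt (isOpen_ball.mem_nhds (hsub hx.1))).continuousAt
    exact h1.mul (contDiffAt_pd (k := 0) i (hg.contDiffAt_of_norm_le (by norm_num) hx)
      (by norm_num)).continuousAt
  refine Integrable.mono' ((hg.2.2.2.1.mono_set (sdiff_subset.trans hsub)).const_mul K)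
    (hcont.aestronglyMeasurable hms) ((ae_restrict_iff' hms).2 (Eventually.of_forall fun x hx => ?_))
  rw [← inner_gradient_eq_sum_pd]
  refine (norm_inner_le_norm _ _).trans ?_
  gcongr
  exact hK x hx.1

lemma exists_setIntegral_closedBall_lt (hn : 3 ≤ n) {f : Euc n → ℝ} {R ε : ℝ} (hR : 0 < R)
    (hf : IntegrableOn f (closedBall 0 R)) (hε : 0 < ε) :
    ∃ ρ, 0 < ρ ∧ ρ ≤ R ∧ ∀ r ≤ ρ, ∫ x in closedBall (0 : Euc n) r, |f x| < ε := by
  have : Nonempty (Fin n) := ⟨⟨0, by omega⟩⟩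
  set s : ℕ → Set (Euc n) := fun k => closedBall 0 (R / (k + 1))
  have hanti : Antitone s := fun a b hab => closedBall_subset_closedBall (by gcongr)
  have h0 : s 0 = closedBall 0 R := by simp [s]
  have hf0 : IntegrableOn (fun x => |f x|) (s 0) := by rw [h0]; exact hf.abs
  have hlim := tendsto_setIntegral_of_antitone (μ := volume) (f := fun x => |f x|)
    (fun k => isClosed_closedBall.measurableSet) hanti ⟨0, hf0⟩
  have hR0 : Tendsto (fun k : ℕ => R / ((k : ℝ) + 1)) atTop (𝓝 0) :=
    tendsto_const_div_atTop_nhds_zero_nat R |>.comp (tendsto_add_atTop_nat 1) |>.congr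
      fun k => by simp
  have hint : ⋂ k, s k = {0} := by
    ext x
    simp only [s, mem_iInter, mem_closedBall_zero_iff, mem_singleton_iff]
    constructor
    · intro h
      exact norm_le_zero_iff.1 (ge_of_tendsto' hR0 h)
    · rintro rfl k
      simp only [norm_zero]; positivity
  rw [hint, Measure.restrict_singleton] at hlim
  simp only [measure_singleton, zero_smul, integral_zero_measure] at hlim
  obtain ⟨k, hk⟩ := (hlim.eventually (gt_mem_nhds hε)).exists
  have hk1 : R / ((k : ℝ) + 1) ≤ R := div_le_self hR.le (by simp)
  refine ⟨R / (k + 1), by positivity, hk1, fun r hr => lt_of_le_of_lt ?_ hk⟩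
  refine setIntegral_mono_set (hf.mono_set ?_).abs (Eventually.of_forall fun x => abs_nonneg _)
    (closedBall_subset_closedBall hr).eventuallyLE
  exact closedBall_subset_closedBall hk1

lemma IsGreenPole.integrable_mul_shell (hn : 3 ≤ n) (hg : IsGreenPole B 0 g)
    (hP : IsTruncation P P' P'' c) (hS : 0 < S) (hρ1 : ρ < 1)
    (hρ : ∀ x : Euc n, x ≠ 0 → S ≤ fund n x → ‖x‖ ≤ ρ) :
    Integrable fun x => g x * shell P'' S x :=
  integrable_mul_of_tsupport (continuous_shell hn hP hS) (hasCompactSupport_shell hn hP hS hρ)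
    fun _ hx => (hg.contDiffAt_of_norm_le hρ1 (tsupport_shell_subset hn hP hS hρ hx)).continuousAt

lemma IsGreenPole.flux_identity (hn : 3 ≤ n) (hB : ContDiffOn ℝ 1 B (ball 0 1))
    (hg : IsGreenPole B 0 g) (hP : IsTruncation P P' P'' c) (hT : 0 < T) (hTS : T ≤ S)
    (hρ0 : 0 ≤ ρ) (hρ1 : ρ ≤ 1 / 2) (hρ : ∀ x : Euc n, x ≠ 0 → T ≤ fund n x → ‖x‖ ≤ ρ) :
    |(∫ x, g x * shell P'' S x) - ((∫ x, g x * shell P'' T x) + c * (S - T))| ≤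
      2 * S * ∫ x in closedBall (0 : Euc n) ρ, |∑ i, B x i * pd i g x| := by
  have hS := hT.trans_le hTS
  set φ : Euc n → ℝ := fluxTest P c T S with hφdef
  have hφ : ContDiff ℝ (⊤ : ℕ∞) φ := contDiff_fluxTest hn hP hT hTS
  have hts : tsupport φ ⊆ closedBall 0 ρ := tsupport_fluxTest_subset hP hT hTS hρ0 hρ
  have hc : HasCompactSupport φ := HasCompactSupport.of_support_subset_isCompact
    (isCompact_closedBall 0 ρ) ((subset_tsupport _).trans hts)
  have hpd : ∀ i, ContDiff ℝ 1 (pd i φ) := fun i => contDiff_pd i hφ (WithTop.coe_le_coe.2 le_top)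
  have hpts : ∀ i, tsupport (pd i φ) ⊆ closedBall 0 ρ \ {0} := fun i x hx => by
    refine ⟨hts (tsupport_pd_subset i φ hx), fun h => ?_⟩
    rw [mem_singleton_iff.1 h] at hx
    refine notMem_tsupport_iff_eventuallyEq.2 ?_ hx
    filter_upwards [pd_eventuallyEq i (fluxTest_eventuallyEq_const (n := n) hn hP hT hTS)] with y hy
    rw [hy]
    exact pd_const i _
  have hgc : ∀ i, ∀ x ∈ tsupport (pd i φ), ContDiffAt ℝ 3 g x := fun i x hx =>
    hg.contDiffAt_of_norm_le (by linarith) (hpts i hx)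
  have hφ0 : φ 0 = c * (S - T) := by simp [φ, fluxTest]
  have hdr : IntegrableOn (fun x => ∑ i, B x i * pd i g x) (closedBall 0 ρ) :=
    (hg.integrableOn_drift hn hB).mono_set (closedBall_subset_closedBall hρ1)
  have hbound : ∀ x, ‖(∑ i, B x i * pd i g x) * φ x‖ ≤ 2 * S * |∑ i, B x i * pd i g x| := by
    intro x
    rw [norm_mul, Real.norm_eq_abs, Real.norm_eq_abs, mul_comm]
    gcongr
    exact abs_fluxTest_le hP hT hTS x
  have hdr1 : IntegrableOn (fun x => (∑ i, B x i * pd i g x) * φ x) (closedBall 0 ρ) :=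
    Integrable.mono' (hdr.abs.const_mul (2 * S))
      (hdr.aestronglyMeasurable.mul hφ.continuous.aestronglyMeasurable)
      (Eventually.of_forall hbound)
  have hz : ∀ x, x ∉ closedBall (0 : Euc n) ρ → (∑ i, B x i * pd i g x) * φ x = 0 := by
    intro x hx
    rw [image_eq_zero_of_notMem_tsupport fun h => hx (hts h), mul_zero]
  have hdr2 : Integrable fun x => (∑ i, B x i * pd i g x) * φ x :=
    (integrableOn_iff_integrable_of_support_subset fun x hx => by
      by_contra h; exact hx (hz x h)).1 hdr1
  have herr : |∫ x, (∑ i, B x i * pd i g x) * φ x| ≤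
      2 * S * ∫ x in closedBall (0 : Euc n) ρ, |∑ i, B x i * pd i g x| := by
    rw [← setIntegral_eq_integral_of_forall_compl_eq_zero hz, ← integral_const_mul]
    exact norm_integral_le_of_norm_le (hdr.abs.const_mul (2 * S)) (Eventually.of_forall hbound)
  have hw := hg.weak_eq hφ hc (hts.trans (closedBall_subset_ball (by linarith)))
  have i1 : ∀ i, Integrable fun x => pd i g x * pd i φ x := fun i =>
    integrable_mul_of_tsupport (hpd i).continuous (hc.pd i)
      fun x hx => (contDiffAt_pd (k := 0) i (hgc i x hx) (by norm_num)).continuousAt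
  have i2 : ∀ i, Integrable fun x => g x * pd i (pd i φ) x := fun i =>
    integrable_mul_of_tsupport (contDiff_pd (k := 0) i (hpd i) (by norm_num)).continuous
      ((hc.pd i).pd i) fun x hx => (hgc i x (tsupport_pd_subset i _ hx)).continuousAt
  have e : ∀ i, ∫ x, pd i g x * pd i φ x = -∫ x, g x * pd i (pd i φ) x := fun i => by
    rw [integral_mul_pd_eq i (hpd i) (hc.pd i) fun x hx => (hgc i x hx).of_le (by norm_num),
      neg_neg]
  rw [integral_add (integrable_finsetSum _ fun i _ => i1 i) hdr2,
    integral_finsetSum _ fun i _ => i1 i, hφ0] at hw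
  simp only [e, Finset.sum_neg_distrib] at hw
  rw [← integral_finsetSum _ fun i _ => i2 i] at hw
  have e2 : ∀ x, ∑ i, g x * pd i (pd i φ) x = g x * shell P'' T x - g x * shell P'' S x := by
    intro x
    rw [← Finset.mul_sum, ← mul_sub, ← lapl_fluxTest hn hP hT hTS x, lapl]
  simp only [e2] at hw
  rw [integral_sub (hg.integrable_mul_shell hn hP hT (by linarith) hρ)
    (hg.integrable_mul_shell hn hP hS (by linarith) fun x h0 h => hρ x h0 (hTS.trans h))] at hw
  have e3 : (∫ x, g x * shell P'' S x) - ((∫ x, g x * shell P'' T x) + c * (S - T)) =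
      -∫ x, (∑ i, B x i * pd i g x) * φ x := by linarith
  rw [e3, abs_neg]
  exact herr

theorem IsGreenPole.two_sided (hn : 3 ≤ n) (hB : ContDiffOn ℝ 1 B (ball 0 1))
    (hg : IsGreenPole B 0 g) : ∃ ρ W : ℝ, 0 < ρ ∧ ρ ≤ 1 / 4 ∧ 0 < W ∧
      ∀ x : Euc n, x ≠ 0 → ‖x‖ < ρ → fund n x ≤ 2 * Real.exp (2400 * n) * W * g x ∧
        W * g x ≤ 3 * Real.exp (2400 * n) * fund n x := by
  have : Nonempty (Fin n) := ⟨⟨0, by omega⟩⟩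
  obtain ⟨P, P', P'', c, hP⟩ := exists_isTruncation
  obtain ⟨ρ₁, hρ₁, hρ₁4, hH⟩ := hg.harnack hn hB
  obtain ⟨ρ₂, hρ₂, hρ₂2, hsmall⟩ := exists_setIntegral_closedBall_lt hn (by norm_num)
    (hg.integrableOn_drift hn hB) (show (0 : ℝ) < 1 / 8 by norm_num)
  set K := Real.exp (2400 * n)
  set r := min (ρ₁ / 2) ρ₂
  have hr : 0 < r := by positivity
  have hr1 : r < ρ₁ := (min_le_left _ _).trans_lt (by linarith)
  have hr2 : r ≤ ρ₂ := min_le_right _ _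
  have hr3 : r ≤ 1 / 2 := hr2.trans hρ₂2
  set v : Euc n := EuclideanSpace.single ⟨0, by omega⟩ r
  have hv : ‖v‖ = r := by simp [v, abs_of_pos hr]
  have hv0 : v ≠ 0 := norm_pos_iff.1 (by rw [hv]; exact hr)
  set T := fund n v
  have hT : 0 < T := fund_pos hv0
  have hρ : ∀ x : Euc n, x ≠ 0 → T ≤ fund n x → ‖x‖ ≤ r := by
    intro x h0 h
    by_contra! hlt
    exact (fund_lt_fund hn hv0 (by rwa [hv])).not_ge h
  set G := ∫ x, g x * shell P'' T x
  set W := ∫ x : Euc n, shell P'' T x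
  have hgpos : ∀ x : Euc n, x ≠ 0 → ‖x‖ ≤ r → 0 < g x := fun x h0 hx =>
    hg.1 x (mem_ball_zero_iff.2 (by linarith)) h0
  have hG : 0 ≤ G := integral_nonneg fun x => by
    by_cases h : shell P'' T x = 0
    · simp [h]
    · have h0 : x ≠ 0 := fun h0 => h (by rw [h0, shell_zero hn hP hT])
      have h1 : T ≤ fund n x := by
        by_contra! h1; exact h (shell_eq_zero_of_fund_lt hP hT h1)
      exact mul_nonneg (hgpos x h0 (hρ x h0 h1)).le (shell_nonneg hP hT x)
  obtain ⟨ρ₃, hρ₃, hbig⟩ := exists_lt_fund hn (max (4 * T) (2 * G))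
  have key : ∀ x : Euc n, x ≠ 0 → ‖x‖ < ρ₃ →
      fund n x ≤ 2 * (K * g x * W) ∧ g x * W ≤ 3 * K * fund n x := by
    intro x h0 hx
    set S := fund n x with hSdef
    obtain ⟨hS4, hSG⟩ := max_lt_iff.1 (hbig x h0 hx)
    have hS : 0 < S := fund_pos h0
    have hTS : T ≤ S := by linarith
    have hρS : ∀ x : Euc n, x ≠ 0 → S ≤ fund n x → ‖x‖ ≤ r := fun x h0 h => hρ x h0 (hTS.trans h)
    have hflux := hg.flux_identity hn hB hP hT hTS hr.le hr3 hρ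
    have hs := hsmall r hr2
    have hW : ∫ x : Euc n, shell P'' S x = W := integral_shell_eq hn hP hT hTS hr.le hρ
    have iS : Integrable (shell P'' S : Euc n → ℝ) := (continuous_shell hn hP
      hS).integrable_of_hasCompactSupport (hasCompactSupport_shell hn hP hS hρS)
    have igS := hg.integrable_mul_shell hn hP hS (by linarith) hρS
    have hcmp : ∀ y, g y * shell P'' S y ≤ K * g x * shell P'' S y ∧
        g x * shell P'' S y ≤ K * (g y * shell P'' S y) := by
      intro y
      by_cases h : shell P'' S y = 0
      · simp [h]
      · have hy0 : y ≠ 0 := fun h0 => h (by rw [h0, shell_zero hn hP hS])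
        have h1 : S ≤ fund n y := by
          by_contra! h1; exact h (shell_eq_zero_of_fund_lt hP hS h1)
        have h2 : fund n y ≤ 2 * S := by
          by_contra! h1; exact h (shell_eq_zero_of_lt_fund hP hS h1)
        have hyx : ‖y‖ ≤ ‖x‖ := by
          by_contra! hlt
          exact (fund_lt_fund hn h0 hlt).not_ge h1
        have hxy : ‖x‖ ≤ 2 * ‖y‖ := by
          by_contra! hlt
          exact (two_mul_fund_lt hn hy0 hlt).not_ge h2
        have hxr : ‖x‖ < ρ₁ := (hρS x h0 le_rfl).trans_lt hr1
        have hsn := shell_nonneg hP hS y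
        have hn0 := norm_nonneg x
        have hyx2 : ‖y‖ ≤ 2 * ‖x‖ := by linarith
        refine ⟨mul_le_mul_of_nonneg_right (hH y x hy0 h0 (by linarith) hxr hyx2 hxy) hsn, ?_⟩
        rw [← mul_assoc]
        exact mul_le_mul_of_nonneg_right (hH x y h0 hy0 hxr (by linarith) hxy hyx2) hsn
    have hup : ∫ y, g y * shell P'' S y ≤ K * g x * W := by
      rw [← hW, ← integral_const_mul]
      exact integral_mono igS (iS.const_mul _) fun y => (hcmp y).1
    have hlo : g x * W ≤ K * ∫ y, g y * shell P'' S y := by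
      rw [← hW, ← integral_const_mul, ← integral_const_mul]
      exact integral_mono (iS.const_mul _) (igS.const_mul _) fun y => (hcmp y).2
    obtain ⟨f1, f2⟩ := abs_le.1 hflux
    have hc1 := hP.one_le
    have hc2 := hP.le_two
    have he : 2 * S * ∫ x in closedBall (0 : Euc n) r, |∑ i, B x i * pd i g x| ≤ S / 4 := by
      nlinarith
    have hI1 : S / 2 ≤ ∫ y, g y * shell P'' S y := by nlinarith
    have hI2 : ∫ y, g y * shell P'' S y ≤ 3 * S := by nlinarith
    have hK : 0 < K := Real.exp_pos _
    refine ⟨by linarith, hlo.trans ?_⟩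
    nlinarith
  have hr4 : r ≤ 1 / 4 := by linarith
  refine ⟨min r ρ₃, W, by positivity, (min_le_left _ _).trans hr4, ?_, ?_⟩
  · set u : Euc n := EuclideanSpace.single ⟨0, by omega⟩ (min r ρ₃ / 2)
    have hm : 0 < min r ρ₃ := by positivity
    have hu : ‖u‖ = min r ρ₃ / 2 := by simp [u, abs_of_pos hm]
    have hu0 : u ≠ 0 := norm_pos_iff.1 (by rw [hu]; positivity)
    have hu1 : ‖u‖ < min r ρ₃ := by rw [hu]; linarith
    obtain ⟨hur, hu3⟩ := lt_min_iff.1 hu1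
    have h1 := (key u hu0 hu3).1
    have h2 := fund_pos hu0
    have h3 : 0 < K * g u := mul_pos (Real.exp_pos _) (hgpos u hu0 hur.le)
    by_contra! hW
    nlinarith
  · intro x h0 hx
    obtain ⟨h1, h2⟩ := key x h0 (lt_min_iff.1 hx).2
    exact ⟨by linarith, by linarith⟩

end TwoSided

/-! ### Touching the level sets with radial profiles -/

section Touching

variable {n : ℕ} {B : Euc n → Euc n} {g : Euc n → ℝ} {A ρ r : ℝ} {p : Euc n}

lemma radialDeriv_eq_fderiv (g : Euc n → ℝ) (p : Euc n) :
    radialDeriv g p = ‖p‖⁻¹ * fderiv ℝ g p p := by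
  rw [radialDeriv, real_inner_smul_right, inner_gradient_left]

lemma radialDeriv_fund (hn : 3 ≤ n) (hp : p ≠ 0) :
    radialDeriv (fund n) p * ‖p‖ ^ (n - 1) = -((n : ℝ) - 2) := by
  have hp0 : 0 < ‖p‖ := norm_pos_iff.2 hp
  have h2 : 0 < ‖p‖ ^ 2 := by positivity
  rw [radialDeriv, real_inner_smul_right, real_inner_comm, inner_gradient_eq_sum_pd]
  simp only [pd_fund hp]
  have e1 : ∑ i, p i * (-((n : ℝ) - 2) * (‖p‖ ^ 2) ^ (-((n : ℝ) - 2) / 2 - 1) * p i) =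
      -((n : ℝ) - 2) * (‖p‖ ^ 2) ^ (-((n : ℝ) - 2) / 2 - 1) * ‖p‖ ^ 2 := by
    rw [EuclideanSpace.real_norm_sq_eq, Finset.mul_sum]
    exact Finset.sum_congr rfl fun i _ => by ring
  have e2 : (‖p‖ ^ 2) ^ (-((n : ℝ) - 2) / 2 - 1) * ‖p‖ ^ 2 = (‖p‖ ^ (n - 2))⁻¹ := by
    rw [← Real.rpow_add_one h2.ne', ← Real.rpow_natCast ‖p‖ 2, ← Real.rpow_mul hp0.le,
      ← Real.rpow_natCast ‖p‖ (n - 2), ← Real.rpow_neg hp0.le, Nat.cast_sub (by omega)]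
    congr 1
    push_cast
    ring
  have e3 : ‖p‖ ^ (n - 1) = ‖p‖ ^ (n - 2) * ‖p‖ := by
    rw [← pow_succ]; congr 1; omega
  rw [e1, mul_assoc _ _ (‖p‖ ^ 2), e2, e3]
  field_simp

lemma exists_euc_norm_eq (hn : 3 ≤ n) (hr : 0 ≤ r) : ∃ v : Euc n, ‖v‖ = r :=
  ⟨EuclideanSpace.single ⟨0, by omega⟩ r, by simp [abs_of_nonneg hr]⟩

lemma isCompact_annulus (a b : ℝ) : IsCompact (closedBall (0 : Euc n) b \ ball 0 a) :=
  (isCompact_closedBall 0 b).diff isOpen_ball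

theorem IsGreenPole.exists_isMinPoint (hn : 3 ≤ n) (hg : IsGreenPole B 0 g) (hA : 0 < A)
    (hr : 0 < r) (hr1 : r < 1) (hlow : ∀ x : Euc n, x ≠ 0 → ‖x‖ ≤ r → 2 * A * fund n x ≤ g x) :
    ∃ p, IsMinPoint g p ∧ ‖p‖ ≤ r ∧
      ((n : ℝ) - 2) * A ≤ |radialDeriv g p| * ‖p‖ ^ (n - 1) := by
  set f : Euc n → ℝ := fun x => g x - A * fund n x with hf
  have hgd : ∀ x : Euc n, x ≠ 0 → ‖x‖ ≤ r → DifferentiableAt ℝ g x := fun x h0 hx =>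
    (hg.contDiffAt ⟨mem_ball_zero_iff.2 (by linarith), h0⟩).differentiableAt (by norm_num)
  have hsd : ∀ x : Euc n, x ≠ 0 → DifferentiableAt ℝ (fund n) x := fun x h0 =>
    (contDiffAt_fund (m := 1) h0).differentiableAt (by norm_num)
  have hfd : ∀ x : Euc n, x ≠ 0 → ‖x‖ ≤ r → DifferentiableAt ℝ f x := fun x h0 hx =>
    (hgd x h0 hx).sub ((hsd x h0).const_mul A)
  obtain ⟨v, hv⟩ := exists_euc_norm_eq hn hr.le
  obtain ⟨σ, hσ, hbig⟩ := exists_lt_fund hn (f v / A)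
  set a := min σ r
  have ha : 0 < a := lt_min hσ hr
  have hne : ∀ {x : Euc n}, x ∉ ball (0 : Euc n) a → x ≠ 0 := fun hx h0 =>
    hx (h0 ▸ mem_ball_self ha)
  obtain ⟨p, ⟨hpr, hpa⟩, hmin⟩ := (isCompact_annulus (n := n) a r).exists_isMinOn
    ⟨v, by simp [hv], by simp [hv, a]⟩
    (f := f) fun x hx => (hfd x (hne hx.2) (mem_closedBall_zero_iff.1
      hx.1)).continuousAt.continuousWithinAt
  rw [mem_closedBall_zero_iff] at hpr
  have hp0 := hne hpa
  have hle : ∀ x : Euc n, x ≠ 0 → ‖x‖ ≤ r → f p ≤ f x := by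
    intro x h0 hx
    by_cases hxa : x ∈ ball (0 : Euc n) a
    · have h1 := hbig x h0 ((mem_ball_zero_iff.1 hxa).trans_le (min_le_left _ _))
      rw [div_lt_iff₀ hA] at h1
      have h2 : f p ≤ f v := hmin ⟨by simp [hv], by simp [hv, a]⟩
      have h3 := hlow x h0 hx
      simp only [hf] at h1 h2 ⊢
      linarith
    · exact hmin ⟨mem_closedBall_zero_iff.2 hx, hxa⟩
  have hloc : IsLocalMinOn f (closedBall 0 r) p := by
    filter_upwards [self_mem_nhdsWithin, nhdsWithin_le_nhds (eventually_ne_nhds hp0)] with x hx h0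
    exact hle x h0 (mem_closedBall_zero_iff.1 hx)
  have hcone : (0 : Euc n) - p ∈ posTangentConeAt (closedBall 0 r) p :=
    mem_posTangentConeAt_of_segment_subset <| (convex_closedBall 0 r).segment_subset
      (mem_closedBall_zero_iff.2 hpr) (by simpa using hr.le)
  have hder := hloc.hasFDerivWithinAt_nonneg (hfd p hp0 hpr).hasFDerivAt.hasFDerivWithinAt hcone
  have hfder : fderiv ℝ f p = fderiv ℝ g p - A • fderiv ℝ (fund n) p :=
    ((hgd p hp0 hpr).hasFDerivAt.sub ((hsd p hp0).hasFDerivAt.const_mul A)).fderiv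
  rw [zero_sub, map_neg, hfder] at hder
  simp only [sub_apply, smul_apply, smul_eq_mul] at hder
  refine ⟨p, ⟨mem_ball_zero_iff.2 (by linarith), hp0, fun x hx h0 hgx => ?_⟩, hpr, ?_⟩
  · by_contra! hlt
    have h1 := hle x h0 (hlt.le.trans hpr)
    have h2 := fund_lt_fund hn h0 hlt
    simp only [hf] at h1
    nlinarith
  · have h1 := radialDeriv_fund hn hp0
    have hp1 : 0 < ‖p‖ := norm_pos_iff.2 hp0
    have h2 : radialDeriv g p ≤ A * radialDeriv (fund n) p := by
      rw [radialDeriv_eq_fderiv, radialDeriv_eq_fderiv]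
      have : 0 < ‖p‖⁻¹ := by positivity
      nlinarith
    have h3 : radialDeriv g p * ‖p‖ ^ (n - 1) ≤ -(((n : ℝ) - 2) * A) := by
      calc _ ≤ A * radialDeriv (fund n) p * ‖p‖ ^ (n - 1) := by gcongr
        _ = _ := by rw [mul_assoc, h1]; ring
    have h4 : -radialDeriv g p * ‖p‖ ^ (n - 1) ≤ |radialDeriv g p| * ‖p‖ ^ (n - 1) := by
      gcongr; exact neg_le_abs _
    linarith

lemma IsGreenPole.exists_bound (hg : IsGreenPole B 0 g) (hr : 0 < r) :
    ∃ S, ∀ x ∈ ball (0 : Euc n) 1, r ≤ ‖x‖ → g x ≤ S := by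
  obtain ⟨t, ht1, ht⟩ := hg.2.2.2.2.1 1 one_pos
  obtain ⟨S, hS⟩ := (isCompact_annulus (n := n) r t).exists_bound_of_continuousOn (f := g)
    fun x hx => (hg.contDiffAt ⟨closedBall_subset_ball ht1 hx.1, fun h0 =>
      hx.2 (mem_singleton_iff.1 h0 ▸ mem_ball_self hr)⟩).continuousAt.continuousWithinAt
  refine ⟨max 1 S, fun x hx hrx => ?_⟩
  rcases lt_or_ge t ‖x‖ with h | h
  · exact (le_abs_self _).trans ((ht x hx h).le.trans (le_max_left _ _))
  · exact (le_abs_self _).trans ((hS x ⟨mem_closedBall_zero_iff.2 h, by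
      simpa using hrx⟩).trans (le_max_right _ _))

theorem IsGreenPole.exists_isMaxPoint {c₀ : ℝ} (hn : 3 ≤ n) (hg : IsGreenPole B 0 g) (hA : 0 < A)
    (hc₀ : 0 < c₀) (hr : 0 < r) (hr1 : r < 1)
    (hlow : ∀ x : Euc n, x ≠ 0 → ‖x‖ ≤ r → c₀ * fund n x ≤ g x)
    (hup : ∀ x : Euc n, x ≠ 0 → ‖x‖ ≤ r → 2 * g x ≤ A * fund n x) :
    ∃ p, IsMaxPoint g p ∧ ‖p‖ ≤ r ∧
      |radialDeriv g p| * ‖p‖ ^ (n - 1) ≤ ((n : ℝ) - 2) * A := by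
  obtain ⟨S, hS⟩ := hg.exists_bound hr
  obtain ⟨σ, hσ, hqbig⟩ := exists_lt_fund hn (max (2 * S / c₀) 0)
  obtain ⟨q, hq⟩ := exists_euc_norm_eq (r := min (σ / 2) (r / 2)) hn (by positivity)
  have hq0 : q ≠ 0 := norm_pos_iff.1 (by rw [hq]; positivity)
  have hqσ : ‖q‖ < σ := by rw [hq]; exact (min_le_left _ _).trans_lt (by linarith)
  have hqr : ‖q‖ < r := by rw [hq]; exact (min_le_right _ _).trans_lt (by linarith)
  have hsq := fund_pos hq0
  have hqS : 2 * S < fund n q * c₀ :=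
    (div_lt_iff₀ hc₀).1 ((le_max_left _ _).trans_lt (hqbig q hq0 hqσ))
  set τ := fund n q * (2 * A / c₀) with hτdef
  have hτ : 0 < τ := by positivity
  set h : ℝ → ℝ := fun s => A * s ^ 2 / (s + τ) with hh
  have hhd : ∀ s, 0 < s → HasDerivAt h (A * (s ^ 2 + 2 * s * τ) / (s + τ) ^ 2) s := by
    intro s hs
    have h1 : HasDerivAt (fun s : ℝ => A * s ^ 2) (A * (2 * s)) s := by
      simpa using (hasDerivAt_pow 2 s).const_mul A
    exact (h1.div ((hasDerivAt_id s).add_const τ) (by simp only [id]; positivity)).congr_deriv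
      (by simp only [id]; ring)
  have hmono : ∀ s t, 0 < s → s < t → h s < h t := by
    intro s t hs hst
    have ht := hs.trans hst
    simp only [hh]
    rw [div_lt_div_iff₀ (by positivity) (by positivity)]
    have h1 : 0 < A * (t - s) * (s * t + τ * (s + t)) := by
      have := sub_pos.2 hst
      positivity
    nlinarith
  set f : Euc n → ℝ := fun x => g x - h (fund n x) with hf
  have hgd : ∀ x : Euc n, x ≠ 0 → ‖x‖ ≤ r → DifferentiableAt ℝ g x := fun x h0 hx =>
    (hg.contDiffAt ⟨mem_ball_zero_iff.2 (by linarith), h0⟩).differentiableAt (by norm_num)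
  have hsd : ∀ x : Euc n, x ≠ 0 → DifferentiableAt ℝ (fund n) x := fun x h0 =>
    (contDiffAt_fund (m := 1) h0).differentiableAt (by norm_num)
  have hcd : ∀ x : Euc n, x ≠ 0 → HasFDerivAt (fun x => h (fund n x))
      ((A * (fund n x ^ 2 + 2 * fund n x * τ) / (fund n x + τ) ^ 2) • fderiv ℝ (fund n) x) x :=
    fun x h0 => (hhd _ (fund_pos h0)).comp_hasFDerivAt x (hsd x h0).hasFDerivAt
  have hfq : S < f q ∧ 0 < f q := by
    have h1 := hlow q hq0 hqr.le
    have h2 : h (fund n q) ≤ c₀ / 2 * fund n q := by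
      simp only [hh]
      rw [div_le_iff₀ (by positivity)]
      have : c₀ / 2 * fund n q * (fund n q + τ) = c₀ / 2 * fund n q ^ 2 + A * fund n q ^ 2 := by
        rw [hτdef]; field_simp
      rw [this]
      have : 0 ≤ c₀ / 2 * fund n q ^ 2 := by positivity
      linarith
    have h3 : 0 < fund n q * c₀ := by positivity
    simp only [hf]
    constructor <;> linarith
  obtain ⟨σ', hσ', hbig⟩ := exists_lt_fund hn τ
  have hnear : ∀ x : Euc n, x ≠ 0 → ‖x‖ ≤ r → ‖x‖ < σ' → f x ≤ 0 := by
    intro x h0 hxr hx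
    have h1 := hbig x h0 hx
    have h2 := hup x h0 hxr
    have h3 := fund_pos h0
    have h4 : A * fund n x / 2 ≤ h (fund n x) := by
      simp only [hh]
      rw [div_le_div_iff₀ (by positivity) (by positivity)]
      have : 0 ≤ A * fund n x * (fund n x - τ) := mul_nonneg (by positivity) (by linarith)
      nlinarith
    simp only [hf]
    linarith
  set a := min σ' ‖q‖
  have ha : 0 < a := lt_min hσ' (norm_pos_iff.2 hq0)
  have hne : ∀ {x : Euc n}, x ∉ ball (0 : Euc n) a → x ≠ 0 := fun hx h0 =>
    hx (h0 ▸ mem_ball_self ha)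
  have hqmem : q ∈ closedBall (0 : Euc n) r \ ball 0 a :=
    ⟨mem_closedBall_zero_iff.2 hqr.le, by simp [a]⟩
  obtain ⟨p, ⟨hpr, hpa⟩, hmax⟩ := (isCompact_annulus (n := n) a r).exists_isMaxOn ⟨q, hqmem⟩
    (f := f) fun x hx => ((hgd x (hne hx.2) (mem_closedBall_zero_iff.1 hx.1)).sub
      (hcd x (hne hx.2)).differentiableAt).continuousAt.continuousWithinAt
  rw [mem_closedBall_zero_iff] at hpr
  have hp0 := hne hpa
  have hqp : f q ≤ f p := hmax hqmem
  have hle : ∀ x ∈ ball (0 : Euc n) 1, x ≠ 0 → f x ≤ f p := by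
    intro x hx h0
    rcases le_or_gt r ‖x‖ with hrx | hxr
    · have h1 := hS x hx hrx
      have h2 : 0 ≤ h (fund n x) := by have := fund_pos h0; simp only [hh]; positivity
      have h3 := hfq.1
      simp only [hf] at h3 hqp ⊢
      linarith
    · by_cases hxa : x ∈ ball (0 : Euc n) a
      · exact (hnear x h0 hxr.le ((mem_ball_zero_iff.1 hxa).trans_le (min_le_left _ _))).trans
          (hfq.2.le.trans hqp)
      · exact hmax ⟨mem_closedBall_zero_iff.2 hxr.le, hxa⟩
  have hpball : p ∈ ball (0 : Euc n) 1 := mem_ball_zero_iff.2 (by linarith)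
  have hloc : IsLocalMax f p := by
    filter_upwards [isOpen_punctured_ball.mem_nhds (show p ∈ ball (0 : Euc n) 1 \ {0} from
      ⟨hpball, hp0⟩)] with x hx
    exact hle x hx.1 hx.2
  have hder : fderiv ℝ g p =
      (A * (fund n p ^ 2 + 2 * fund n p * τ) / (fund n p + τ) ^ 2) • fderiv ℝ (fund n) p :=
    sub_eq_zero.1 (hloc.hasFDerivAt_eq_zero ((hgd p hp0 hpr).hasFDerivAt.sub (hcd p hp0)))
  refine ⟨p, ⟨hpball, hp0, fun x hx h0 hgx => ?_⟩, hpr, ?_⟩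
  · by_contra! hlt
    have h1 := hle x hx h0
    have h2 := hmono _ _ (fund_pos h0) (fund_lt_fund hn hp0 hlt)
    simp only [hf] at h1
    linarith
  · have hn2 : (0 : ℝ) ≤ (n : ℝ) - 2 := by
      have : (3 : ℝ) ≤ n := by exact_mod_cast hn
      linarith
    have hsp := fund_pos hp0
    set D := A * (fund n p ^ 2 + 2 * fund n p * τ) / (fund n p + τ) ^ 2 with hD
    have hD0 : 0 ≤ D := by positivity
    have hDA : D ≤ A := by
      rw [hD, div_le_iff₀ (by positivity)]
      nlinarith [mul_pos hA (pow_pos hτ 2)]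
    have e : radialDeriv g p = D * radialDeriv (fund n) p := by
      rw [radialDeriv_eq_fderiv, radialDeriv_eq_fderiv, hder]
      simp only [smul_apply, smul_eq_mul]
      ring
    have e2 : |radialDeriv g p| * ‖p‖ ^ (n - 1) = D * ((n : ℝ) - 2) := by
      rw [← abs_of_nonneg (show 0 ≤ ‖p‖ ^ (n - 1) by positivity), ← abs_mul, e, mul_assoc,
        radialDeriv_fund hn hp0, abs_mul, abs_neg, abs_of_nonneg hD0, abs_of_nonneg hn2]
    rw [e2, mul_comm]
    gcongr

end Touching

/-- there is a constant `M₀`, depending only on `n`, `M`, `β`, such that for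
every admissible drift and Green's function `g` with pole at `0`, there are sequences of
minimum points `a_k` and maximum points `b_k`, both tending to `0`, with
`|∂g/∂r(b_k)| |b_k|^{n-1} < M₀ |∂g/∂r(a_k)| |a_k|^{n-1}` for all `k`. -/
theorem min_max_radial_derivative_comparison
    (n : ℕ) (hn : 3 ≤ n) (β M : ℝ) (hβ0 : 0 < β) (hβ1 : β < 1) (hM : 0 < M) :
    ∃ M₀ > (0 : ℝ), ∀ (B : Euc n → Euc n) (g : Euc n → ℝ),
      AdmissibleDrift β M B → IsGreenPole B (0 : Euc n) g →
      ∃ a b : ℕ → Euc n,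
        (∀ k, IsMinPoint g (a k)) ∧ (∀ k, IsMaxPoint g (b k)) ∧
        Filter.Tendsto (fun k => ‖a k‖) Filter.atTop (nhds 0) ∧
        Filter.Tendsto (fun k => ‖b k‖) Filter.atTop (nhds 0) ∧
        ∀ k, |radialDeriv g (b k)| * ‖b k‖ ^ (n - 1)
            < M₀ * (|radialDeriv g (a k)| * ‖a k‖ ^ (n - 1)) := by
  have hn3 : (3 : ℝ) ≤ n := by exact_mod_cast hn
  set K := Real.exp (2400 * n)
  have hK : 0 < K := Real.exp_pos _
  refine ⟨25 * K ^ 2, by positivity, fun B g hB hg => ?_⟩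
  obtain ⟨ρ, W, hρ, hρ4, hW, h⟩ := hg.two_sided hn hB.1
  set r : ℕ → ℝ := fun k => ρ / 2 / ((k : ℝ) + 1) with hr
  have hr0 : ∀ k, 0 < r k := fun k => by positivity
  have hrρ : ∀ k, r k < ρ := fun k =>
    (div_le_self (by positivity) (by simp)).trans_lt (by linarith)
  have hr1 : ∀ k, r k < 1 := fun k => (hrρ k).trans_le (by linarith)
  have hlim : Tendsto r atTop (𝓝 0) :=
    tendsto_const_div_atTop_nhds_zero_nat (ρ / 2) |>.comp (tendsto_add_atTop_nat 1) |>.congr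
      fun k => by simp [hr]
  have hlow : ∀ k, ∀ x : Euc n, x ≠ 0 → ‖x‖ ≤ r k → 1 / (2 * K * W) * fund n x ≤ g x := by
    intro k x h0 hx
    rw [one_div_mul_eq_div, div_le_iff₀' (by positivity)]
    exact (h x h0 (hx.trans_lt (hrρ k))).1
  have hup : ∀ k, ∀ x : Euc n, x ≠ 0 → ‖x‖ ≤ r k → 2 * g x ≤ 6 * K / W * fund n x := by
    intro k x h0 hx
    have := (h x h0 (hx.trans_lt (hrρ k))).2
    rw [div_mul_eq_mul_div, le_div_iff₀ hW]
    linarith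
  choose a ha har haA using fun k => hg.exists_isMinPoint (A := 1 / (4 * K * W)) hn (by positivity)
    (hr0 k) (hr1 k) fun x h0 hx => by
      rw [show 2 * (1 / (4 * K * W)) = 1 / (2 * K * W) by field_simp; norm_num]
      exact hlow k x h0 hx
  choose b hb hbr hbA using fun k => hg.exists_isMaxPoint (A := 6 * K / W)
    (c₀ := 1 / (2 * K * W)) hn (by positivity) (by positivity) (hr0 k) (hr1 k) (hlow k) (hup k)
  refine ⟨a, b, ha, hb, squeeze_zero (fun k => norm_nonneg _) har hlim,
    squeeze_zero (fun k => norm_nonneg _) hbr hlim, fun k => (hbA k).trans_lt ?_⟩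
  calc ((n : ℝ) - 2) * (6 * K / W) < ((n : ℝ) - 2) * (25 / 4 * K / W) := by
        have : 0 < (n : ℝ) - 2 := by linarith
        gcongr
        norm_num
    _ = 25 * K ^ 2 * (((n : ℝ) - 2) * (1 / (4 * K * W))) := by field_simp
    _ ≤ _ := mul_le_mul_of_nonneg_left (haA k) (by positivity)
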